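/- arXiv:2308.01107 — 6 statements merged into one kernel-verified Lean document; each statement's English description precedes it below -/
import Mathlib

section
/- Let K ⊆ Ω₀ = {(z,w) ∈ ℂ × ℂ : z·w ≠ 1} be compact. Set K₁ = {(z,w) ∈ K : |w| ≤ 1}, K₂ = {(z,w) ∈ K : |w| ≥ 1}, M = max{1, sup_{(z,w)∈K₁} |z/(1−zw)|, sup_{(z,w)∈K₂} |zw/(1−zw)|} (suprema over the empty set taken to be 0), and let B = {(u,v) ∈ ℂ² : |u| ≤ 2M, |v| ≤ 2M}. Then for every entire function F : ℂ² → ℂ whose Taylor coefficients a_{p,q} at the origin vanish whenever p < q, one has Σ_{p ≥ q} |a_{p,q}| · sup_{(z,w)∈K} |f_{p,q}(z,w)| ≤ (8/3) · sup_{(u,v)∈B} |F(u,v)|. -/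
open Complex

/-- The affine chart of the complement of the complexified unit circle. -/
def Omega0 : Set (ℂ × ℂ) := {p | p.1 * p.2 ≠ 1}

/-- The basis functions f_{p,q}(z,w) = z^p w^q / (1−zw)^{max(p,q)}. -/
noncomputable def fpq (p q : ℕ) (zw : ℂ × ℂ) : ℂ :=
  zw.1 ^ p * zw.2 ^ q / (1 - zw.1 * zw.2) ^ max p q

/-- **Cauchy's estimate** for the coefficients of an everywhere convergent power series. -/
theorem norm_coeff_mul_pow_le_of_hasSum {c : ℕ → ℂ} {f : ℂ → ℂ}
    (hf : ∀ z, HasSum (fun n => c n * z ^ n) (f z)) {R C : ℝ} (hR : 0 < R)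
    (hC : ∀ z, ‖z‖ = R → ‖f z‖ ≤ C) (n : ℕ) : ‖c n‖ * R ^ n ≤ C := by
  have hball : HasFPowerSeriesOnBall f (FormalMultilinearSeries.ofScalars ℂ c) 0 ⊤ := by
    refine ⟨?_, ENNReal.zero_lt_top, fun {y} _ => ?_⟩
    · rw [top_le_iff]
      refine FormalMultilinearSeries.radius_eq_top_of_summable_norm _ fun r => ?_
      refine (hf r).summable.norm.congr fun k => ?_
      simp
    · simpa [mul_comm] using hf y
  have hdiff : Differentiable ℂ f := fun z =>
    (hball.differentiableOn z (by simp)).differentiableAt (by simp)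
  have hcoeff : iteratedDeriv n f 0 = n.factorial * c n := by
    have h := hball.factorial_smul (1 : ℂ) n
    rw [iteratedDeriv_eq_iteratedFDeriv, ← h]
    simp
  have hcauchy := Complex.norm_iteratedDeriv_le_of_forall_mem_sphere_norm_le n hR
    hdiff.diffContOnCl (c := 0) (C := C) fun z hz => hC z (by simpa using hz)
  rw [hcoeff, norm_mul, Complex.norm_natCast, mul_div_assoc] at hcauchy
  have hfac : (0 : ℝ) < n.factorial := by positivity
  exact (le_div_iff₀ (by positivity)).1 (le_of_mul_le_mul_left hcauchy hfac)

/-- **Cauchy's estimate** for the coefficients of an everywhere convergent double power series. -/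
theorem norm_coeff_mul_pow_add_le_of_hasSum {a : ℕ → ℕ → ℂ} {F : ℂ × ℂ → ℂ}
    (ha : ∀ u v : ℂ, HasSum (fun pq : ℕ × ℕ => a pq.1 pq.2 * u ^ pq.1 * v ^ pq.2) (F (u, v)))
    {R C : ℝ} (hR : 0 < R) (hC : ∀ u v, ‖u‖ = R → ‖v‖ = R → ‖F (u, v)‖ ≤ C) (p q : ℕ) :
    ‖a p q‖ * R ^ (p + q) ≤ C := by
  have hrow : ∀ (p : ℕ) (v : ℂ), Summable fun q => a p q * v ^ q := fun p v => by
    simpa using (ha 1 v).summable.prod_factor p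
  have hcol : ∀ u v : ℂ, HasSum (fun p => (∑' q, a p q * v ^ q) * u ^ p) (F (u, v)) := by
    intro u v
    refine (ha u v).prod_fiberwise fun p => ?_
    simpa only [mul_right_comm] using (hrow p v).hasSum.mul_right (u ^ p)
  have hv : ∀ v : ℂ, ‖v‖ = R → ‖∑' q, a p q * v ^ q‖ ≤ C / R ^ p := fun v hv =>
    (le_div_iff₀ (by positivity)).2 <|
      norm_coeff_mul_pow_le_of_hasSum (fun u => hcol u v) hR (fun u hu => hC u v hu hv) p
  have h := norm_coeff_mul_pow_le_of_hasSum (fun v => (hrow p v).hasSum) hR hv q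
  rw [le_div_iff₀ (by positivity)] at h
  rwa [pow_add, mul_comm (R ^ p), ← mul_assoc]

theorem hasSum_half_pow_add_of_le :
    HasSum (fun pq : {pq : ℕ × ℕ // pq.2 ≤ pq.1} => (1 / 2 : ℝ) ^ (pq.1.1 + pq.1.2)) (8 / 3) := by
  let e : ℕ × ℕ ≃ {pq : ℕ × ℕ // pq.2 ≤ pq.1} :=
    { toFun := fun x => ⟨(x.1 + x.2, x.1), Nat.le_add_right _ _⟩
      invFun := fun y => (y.1.2, y.1.1 - y.1.2)
      left_inv := fun x => by simp
      right_inv := fun y => Subtype.ext (Prod.ext (Nat.add_sub_of_le y.2) rfl) }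
  rw [← e.hasSum_iff]
  have h4 : HasSum (fun n : ℕ => (1 / 4 : ℝ) ^ n) (1 - 1 / 4)⁻¹ :=
    hasSum_geometric_of_lt_one (by norm_num) (by norm_num)
  have h2 : HasSum (fun n : ℕ => (1 / 2 : ℝ) ^ n) (1 - 1 / 2)⁻¹ :=
    hasSum_geometric_of_lt_one (by norm_num) (by norm_num)
  have h := h4.mul h2 (h4.summable.mul_of_nonneg h2.summable
    (fun n => by positivity) (fun n => by positivity))
  have hval : (1 - 1 / 4 : ℝ)⁻¹ * (1 - 1 / 2)⁻¹ = 8 / 3 := by norm_num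
  rw [hval] at h
  refine (congrArg (fun g => HasSum g (8 / 3 : ℝ)) (funext fun x => ?_)).mpr h
  have hquarter : (1 / 4 : ℝ) = (1 / 2) ^ 2 := by norm_num
  simp only [Function.comp_apply, e, Equiv.coe_fn_mk, hquarter, ← pow_mul, ← pow_add]
  congr 1
  ring

theorem norm_fpq_le_pow {p q : ℕ} (hqp : q ≤ p) {M : ℝ} {zw : ℂ × ℂ}
    (h₁ : ‖zw.2‖ ≤ 1 → ‖zw.1 / (1 - zw.1 * zw.2)‖ ≤ M)
    (h₂ : 1 ≤ ‖zw.2‖ → ‖zw.1 * zw.2 / (1 - zw.1 * zw.2)‖ ≤ M) :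
    ‖fpq p q zw‖ ≤ M ^ p := by
  have hf : fpq p q zw = (zw.1 / (1 - zw.1 * zw.2)) ^ p * zw.2 ^ q := by
    rw [fpq, max_eq_left hqp, div_pow]
    ring
  rw [hf, norm_mul, norm_pow, norm_pow]
  rcases le_total ‖zw.2‖ 1 with hw | hw
  · calc _ ≤ ‖zw.1 / (1 - zw.1 * zw.2)‖ ^ p * 1 := by
          gcongr
          exact pow_le_one₀ (norm_nonneg _) hw
      _ ≤ M ^ p := by
          rw [mul_one]
          exact pow_le_pow_left₀ (norm_nonneg _) (h₁ hw) p
  · calc _ ≤ ‖zw.1 / (1 - zw.1 * zw.2)‖ ^ p * ‖zw.2‖ ^ p := by gcongr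
      _ = ‖zw.1 * zw.2 / (1 - zw.1 * zw.2)‖ ^ p := by
          rw [← mul_pow, ← norm_mul, div_mul_eq_mul_div]
      _ ≤ M ^ p := pow_le_pow_left₀ (norm_nonneg _) (h₂ hw) p

theorem bddAbove_range_norm_of_isCompact {X E : Type*} [TopologicalSpace X]
    [SeminormedAddCommGroup E] {s : Set X} (hs : IsCompact s) {g : X → E}
    (hg : ContinuousOn g s) : BddAbove (Set.range fun x : s => ‖g x‖) := by
  have h := hs.bddAbove_image hg.norm
  rwa [Set.image_eq_range] at h

/-- the key estimate. For compact K ⊆ Ω₀, with K₁, K₂, M, B as in the text,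
and any entire F whose Taylor coefficients a_{p,q} vanish for p < q, one has
Σ_{p ≥ q} |a_{p,q}| · sup_K |f_{p,q}| ≤ (8/3) · sup_B |F|. -/
theorem keyEstimate
    (K : Set (ℂ × ℂ)) (hK : IsCompact K) (hKΩ : K ⊆ Omega0)
    (K₁ K₂ : Set (ℂ × ℂ)) (M : ℝ) (B : Set (ℂ × ℂ))
    (hK₁ : K₁ = {p ∈ K | ‖p.2‖ ≤ 1})
    (hK₂ : K₂ = {p ∈ K | 1 ≤ ‖p.2‖})
    (hM : M = max 1 (max
      (⨆ p : K₁, ‖(p : ℂ × ℂ).1 / (1 - (p : ℂ × ℂ).1 * (p : ℂ × ℂ).2)‖)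
      (⨆ p : K₂, ‖(p : ℂ × ℂ).1 * (p : ℂ × ℂ).2 / (1 - (p : ℂ × ℂ).1 * (p : ℂ × ℂ).2)‖)))
    (hB : B = {q : ℂ × ℂ | ‖q.1‖ ≤ 2 * M ∧ ‖q.2‖ ≤ 2 * M})
    (F : ℂ × ℂ → ℂ) (hF : Differentiable ℂ F)
    (a : ℕ → ℕ → ℂ)
    (ha : ∀ u v : ℂ, HasSum (fun pq : ℕ × ℕ => a pq.1 pq.2 * u ^ pq.1 * v ^ pq.2) (F (u, v)))
    (hvan : ∀ p q : ℕ, p < q → a p q = 0) :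
    Summable (fun pq : {pq : ℕ × ℕ // pq.2 ≤ pq.1} =>
      ‖a pq.1.1 pq.1.2‖ * ⨆ zw : K, ‖fpq pq.1.1 pq.1.2 (zw : ℂ × ℂ)‖) ∧
    (∑' pq : {pq : ℕ × ℕ // pq.2 ≤ pq.1},
      ‖a pq.1.1 pq.1.2‖ * ⨆ zw : K, ‖fpq pq.1.1 pq.1.2 (zw : ℂ × ℂ)‖)
      ≤ (8 / 3) * ⨆ uv : B, ‖F (uv : ℂ × ℂ)‖ := by
  have hne : ∀ zw ∈ K, 1 - zw.1 * zw.2 ≠ 0 := fun zw h => sub_ne_zero.2 (hKΩ h).symm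
  have hM1 : 1 ≤ M := hM ▸ le_max_left _ _
  have hM0 : 0 < M := one_pos.trans_le hM1
  have hK₁c : IsCompact K₁ := by
    rw [hK₁]
    exact hK.inter_right (isClosed_le continuous_snd.norm continuous_const)
  have hK₂c : IsCompact K₂ := by
    rw [hK₂]
    exact hK.inter_right (isClosed_le continuous_const continuous_snd.norm)
  have hK₁K : K₁ ⊆ K := hK₁ ▸ Set.sep_subset _ _
  have hK₂K : K₂ ⊆ K := hK₂ ▸ Set.sep_subset _ _
  have hbdd₁ := bddAbove_range_norm_of_isCompact hK₁c
    (g := fun zw : ℂ × ℂ => zw.1 / (1 - zw.1 * zw.2))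
    (ContinuousOn.div (by fun_prop) (by fun_prop) fun zw h => hne zw (hK₁K h))
  have hbdd₂ := bddAbove_range_norm_of_isCompact hK₂c
    (g := fun zw : ℂ × ℂ => zw.1 * zw.2 / (1 - zw.1 * zw.2))
    (ContinuousOn.div (by fun_prop) (by fun_prop) fun zw h => hne zw (hK₂K h))
  have hsup : ∀ p q : ℕ, q ≤ p → ⨆ zw : K, ‖fpq p q (zw : ℂ × ℂ)‖ ≤ M ^ p := by
    intro p q hqp
    refine Real.iSup_le (fun zw => norm_fpq_le_pow hqp (fun hw => ?_) fun hw => ?_) (by positivity)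
    · have hmem : (zw : ℂ × ℂ) ∈ K₁ := hK₁ ▸ ⟨zw.2, hw⟩
      rw [hM]
      exact (le_ciSup hbdd₁ ⟨zw, hmem⟩).trans ((le_max_left _ _).trans (le_max_right _ _))
    · have hmem : (zw : ℂ × ℂ) ∈ K₂ := hK₂ ▸ ⟨zw.2, hw⟩
      rw [hM]
      exact (le_ciSup hbdd₂ ⟨zw, hmem⟩).trans ((le_max_right _ _).trans (le_max_right _ _))
  have hBc : IsCompact B := by
    have hprod : B = Metric.closedBall 0 (2 * M) ×ˢ Metric.closedBall 0 (2 * M) := by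
      ext
      simp [hB]
    rw [hprod]
    exact (isCompact_closedBall _ _).prod (isCompact_closedBall _ _)
  have hbddF := bddAbove_range_norm_of_isCompact hBc hF.continuous.continuousOn
  set S := ⨆ uv : B, ‖F (uv : ℂ × ℂ)‖
  have hcoeff : ∀ p q : ℕ, ‖a p q‖ * (2 * M) ^ (p + q) ≤ S := by
    refine norm_coeff_mul_pow_add_le_of_hasSum ha (by positivity) fun u v hu hv => ?_
    have hmem : (u, v) ∈ B := hB ▸ ⟨hu.le, hv.le⟩
    exact le_ciSup hbddF ⟨(u, v), hmem⟩
  have hterm : ∀ pq : {pq : ℕ × ℕ // pq.2 ≤ pq.1},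
      ‖a pq.1.1 pq.1.2‖ * ⨆ zw : K, ‖fpq pq.1.1 pq.1.2 (zw : ℂ × ℂ)‖ ≤
        (1 / 2 : ℝ) ^ (pq.1.1 + pq.1.2) * S := by
    rintro ⟨⟨p, q⟩, hqp⟩
    calc _ ≤ ‖a p q‖ * M ^ (p + q) := by
          gcongr
          exact (hsup p q hqp).trans (pow_le_pow_right₀ hM1 (Nat.le_add_right p q))
      _ = (1 / 2 : ℝ) ^ (p + q) * (‖a p q‖ * (2 * M) ^ (p + q)) := by
          rw [mul_left_comm, ← mul_pow]
          ring_nf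
      _ ≤ (1 / 2 : ℝ) ^ (p + q) * S := by
          gcongr
          exact hcoeff p q
  have hgeom := hasSum_half_pow_add_of_le.mul_right S
  have hsummable := hgeom.summable.of_nonneg_of_le
    (fun pq => mul_nonneg (norm_nonneg _) (Real.iSup_nonneg fun _ => norm_nonneg _)) hterm
  exact ⟨hsummable, (hsummable.tsum_le_tsum hterm hgeom.summable).trans_eq hgeom.tsum_eq⟩
end

section
/- Let f, g : Ω₀ → ℂ be holomorphic functions on Ω₀ = {(z,w) ∈ ℂ × ℂ : z·w ≠ 1} satisfying g(u,v) = f(1/v, 1/u) for all u,v ∈ ℂ∖{0} with uv ≠ 1. Then there exists a unique family (a_{p,q})_{p,q∈ℕ} of complex numbers such that, for every compact K ⊆ Ω₀, Σ_{p,q} |a_{p,q}| · sup_K |f_{p,q}| < ∞ and Σ_{p,q} |a_{p,q}| · sup_K |g_{p,q}| < ∞, and such that f(z,w) = Σ_{p,q} a_{p,q} f_{p,q}(z,w) and g(u,v) = Σ_{p,q} a_{p,q} g_{p,q}(u,v) for all points of Ω₀. -/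
open Complex

/-- The flip-chart basis functions g_{p,q}(u,v) = f_{p,q}(1/v, 1/u). -/
noncomputable def gpq (p q : ℕ) (uv : ℂ × ℂ) : ℂ :=
  if q ≤ p then uv.1 ^ (p - q) / (uv.1 * uv.2 - 1) ^ p
  else uv.2 ^ (q - p) / (uv.1 * uv.2 - 1) ^ q

/-- The `n`-th Fourier coefficient of the restriction of `φ` to the unit circle. -/
noncomputable def laurentCoeff (φ : ℂ → ℂ) (n : ℤ) : ℂ :=
  (2 * Real.pi : ℂ)⁻¹ *
    ∫ θ in (0 : ℝ)..(2 * Real.pi), φ (exp (θ * I)) * exp (-(n * θ * I))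

lemma laurentCoeff_congr {φ ψ : ℂ → ℂ} (h : ∀ ζ : ℂ, ‖ζ‖ = 1 → φ ζ = ψ ζ) (n : ℤ) :
    laurentCoeff φ n = laurentCoeff ψ n := by
  unfold laurentCoeff
  simp_rw [fun θ : ℝ => h (exp (θ * I)) (norm_exp_ofReal_mul_I θ)]

lemma exp_add_two_pi_mul_I (θ : ℝ) : exp (((θ + 2 * Real.pi : ℝ) : ℂ) * I) = exp (θ * I) := by
  push_cast
  rw [add_mul, Complex.exp_periodic]

lemma exp_neg_int_add_two_pi_mul_I (n : ℤ) (θ : ℝ) :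
    exp (-(n * ((θ + 2 * Real.pi : ℝ) : ℂ) * I)) = exp (-(n * θ * I)) := by
  have : -(n * ((θ + 2 * Real.pi : ℝ) : ℂ) * I) =
      -(n * θ * I) + ((-n : ℤ) : ℂ) * (2 * Real.pi * I) := by push_cast; ring
  rw [this, Complex.exp_add, Complex.exp_int_mul_two_pi_mul_I, mul_one]

lemma periodic_laurent_integrand (φ : ℂ → ℂ) (n : ℤ) :
    Function.Periodic (fun θ : ℝ => φ (exp (θ * I)) * exp (-(n * θ * I))) (2 * Real.pi) := by
  intro θ
  simp only [exp_add_two_pi_mul_I, exp_neg_int_add_two_pi_mul_I]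

lemma laurentCoeff_comp_exp_mul (φ : ℂ → ℂ) (n : ℤ) (α : ℝ) :
    laurentCoeff (fun ζ => φ (ζ * exp (α * I))) n = exp (α * I) ^ n * laurentCoeff φ n := by
  unfold laurentCoeff
  have h1 : ∀ θ : ℝ, φ (exp (θ * I) * exp (α * I)) * exp (-(n * θ * I)) =
      exp (α * I) ^ n * (fun θ : ℝ => φ (exp (θ * I)) * exp (-(n * θ * I))) (θ + α) := by
    intro θ
    have h2 : exp (θ * I) * exp (α * I) = exp (((θ + α : ℝ) : ℂ) * I) := by
      rw [← Complex.exp_add]; congr 1; push_cast; ring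
    have h3 : exp (-(n * θ * I)) = exp (α * I) ^ n * exp (-(n * ((θ + α : ℝ) : ℂ) * I)) := by
      rw [← Complex.exp_int_mul, ← Complex.exp_add]; congr 1; push_cast; ring
    simp only [h2, h3]
    ring
  simp_rw [h1]
  rw [intervalIntegral.integral_const_mul, intervalIntegral.integral_comp_add_right
    (fun θ : ℝ => φ (exp (θ * I)) * exp (-(n * θ * I))) α]
  have := (periodic_laurent_integrand φ n).intervalIntegral_add_eq α 0
  rw [zero_add] at this
  rw [zero_add, add_comm (2 * Real.pi) α, this]
  ring

lemma laurentCoeff_comp_inv (φ : ℂ → ℂ) (n : ℤ) :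
    laurentCoeff (fun ζ => φ ζ⁻¹) n = laurentCoeff φ (-n) := by
  unfold laurentCoeff
  congr 1
  have h1 : ∀ θ : ℝ, φ (exp (θ * I))⁻¹ * exp (-(n * θ * I)) =
      (fun θ : ℝ => φ (exp (θ * I)) * exp (-((-n : ℤ) * θ * I))) (-θ) := by
    intro θ
    simp only
    rw [← Complex.exp_neg]
    congr 3 <;> push_cast <;> ring
  simp_rw [h1]
  rw [intervalIntegral.integral_comp_neg
    (fun θ : ℝ => φ (exp (θ * I)) * exp (-((-n : ℤ) * θ * I)))]
  have := (periodic_laurent_integrand φ (-n)).intervalIntegral_add_eq (-(2 * Real.pi)) 0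
  simpa using this

lemma laurentCoeff_comp_real_mul (φ : ℂ → ℂ) (n : ℤ) {r : ℝ} (hr : 0 < r) :
    laurentCoeff (fun ζ => φ (ζ * r)) n =
      (r : ℂ) ^ n * ((2 * Real.pi * I : ℂ)⁻¹ * ∮ ζ in C(0, r), φ ζ * ζ ^ (-n - 1)) := by
  have hr' : (r : ℂ) ≠ 0 := by exact_mod_cast hr.ne'
  unfold laurentCoeff circleIntegral
  have h1 : ∀ θ : ℝ, deriv (circleMap 0 r) θ • (φ (circleMap 0 r θ) * circleMap 0 r θ ^ (-n - 1)) =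
      (I * (r : ℂ) ^ (-n)) * (φ (exp (θ * I) * r) * exp (-(n * θ * I))) := by
    intro θ
    have hc : circleMap 0 r θ ≠ 0 := by simp [circleMap, hr']
    have h2 : circleMap 0 r θ ^ (-n) = (r : ℂ) ^ (-n) * exp (-(n * θ * I)) := by
      rw [circleMap_zero, mul_zpow, ← Complex.exp_int_mul]
      congr 2; push_cast; ring
    rw [deriv_circleMap, smul_eq_mul, sub_eq_add_neg, zpow_add₀ hc, h2]
    have h3 : exp (θ * I) * r = circleMap 0 r θ := by rw [circleMap_zero]; ring
    rw [h3, zpow_neg_one]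
    field_simp
  simp_rw [h1]
  rw [intervalIntegral.integral_const_mul]
  have hpi : (Real.pi : ℂ) ≠ 0 := by exact_mod_cast Real.pi_ne_zero
  rw [zpow_neg]
  have := zpow_ne_zero n hr'
  generalize (∫ θ in (0 : ℝ)..(2 * Real.pi), φ (exp (θ * I) * r) * exp (-(n * θ * I))) = J
  field_simp

lemma laurentCoeff_comp_mul {φ : ℂ → ℂ} (hφ : DifferentiableOn ℂ φ {0}ᶜ) (n : ℤ) {x : ℂ}
    (hx : x ≠ 0) :
    laurentCoeff (fun ζ => φ (ζ * x)) n = x ^ n * laurentCoeff φ n := by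
  have key : ∀ {r R : ℝ}, 0 < r → r ≤ R →
      (∮ ζ in C(0, R), φ ζ * ζ ^ (-n - 1)) = ∮ ζ in C(0, r), φ ζ * ζ ^ (-n - 1) := by
    intro r R hr hR
    have hd : ∀ ζ : ℂ, ζ ≠ 0 → DifferentiableAt ℂ (fun ζ => φ ζ * ζ ^ (-n - 1)) ζ := fun ζ hζ =>
      ((hφ ζ hζ).differentiableAt (isOpen_compl_singleton.mem_nhds hζ)).mul
        (differentiableAt_zpow.2 (Or.inl hζ))
    refine circleIntegral_eq_of_differentiable_on_annulus_off_countable hr hR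
      Set.countable_empty (fun ζ hζ => (hd ζ ?_).continuousAt.continuousWithinAt)
      (fun ζ hζ => hd ζ ?_)
    · rintro rfl
      exact hζ.2 (Metric.mem_ball_self hr)
    · rintro rfl
      exact hζ.1.2 (Metric.mem_closedBall_self hr.le)
  have key' : ∀ {r : ℝ}, 0 < r → (∮ ζ in C(0, r), φ ζ * ζ ^ (-n - 1)) =
      ∮ ζ in C(0, 1), φ ζ * ζ ^ (-n - 1) := by
    intro r hr
    rcases le_total r 1 with h | h
    · exact (key hr h).symm
    · exact key one_pos h
  have hr : 0 < ‖x‖ := norm_pos_iff.2 hx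
  have hone : laurentCoeff φ n = (2 * Real.pi * I : ℂ)⁻¹ * ∮ ζ in C(0, 1), φ ζ * ζ ^ (-n - 1) := by
    have := laurentCoeff_comp_real_mul φ n one_pos
    simpa using this
  have hx' : x = ‖x‖ * exp (arg x * I) := (norm_mul_exp_arg_mul_I x).symm
  have h1 := laurentCoeff_comp_exp_mul (fun ζ => φ (ζ * ‖x‖)) n (arg x)
  rw [laurentCoeff_comp_real_mul φ n hr, key' hr, ← hone] at h1
  have h2 : (fun ζ => φ (ζ * x)) = fun ζ => φ (ζ * exp (arg x * I) * ‖x‖) := by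
    funext ζ
    conv_lhs => rw [hx']
    ring_nf
  rw [h2, h1]
  conv_rhs => rw [hx', mul_zpow]
  ring

lemma norm_laurentCoeff_le {φ : ℂ → ℂ} {C : ℝ} (h : ∀ ζ : ℂ, ‖ζ‖ = 1 → ‖φ ζ‖ ≤ C) (n : ℤ) :
    ‖laurentCoeff φ n‖ ≤ C := by
  unfold laurentCoeff
  have h1 : ∀ θ ∈ Set.uIoc (0 : ℝ) (2 * Real.pi), ‖φ (exp (θ * I)) * exp (-(n * θ * I))‖ ≤ C := by
    intro θ _
    have : -(n * θ * I) = ((-(n * θ) : ℝ) : ℂ) * I := by push_cast; ring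
    rw [norm_mul, this, norm_exp_ofReal_mul_I, mul_one]
    exact h _ (norm_exp_ofReal_mul_I θ)
  have h2 := intervalIntegral.norm_integral_le_of_norm_le_const h1
  have hpi := Real.pi_pos
  rw [sub_zero, abs_of_pos (by positivity)] at h2
  rw [norm_mul, norm_inv, norm_mul, RCLike.norm_ofNat, norm_real, Real.norm_of_nonneg hpi.le]
  rw [inv_mul_le_iff₀ (by positivity)]
  linarith

lemma hasSum_laurentCoeff_of_hasSum {ι : Type*} [Countable ι] {φ : ℂ → ℂ} (c : ι → ℂ) (k : ι → ℤ)
    (h : ∀ ζ : ℂ, ‖ζ‖ = 1 → HasSum (fun j => c j * ζ ^ k j) (φ ζ)) (m : ℤ) :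
    HasSum (fun j => if k j = m then c j else 0) (laurentCoeff φ m) := by
  have hc : Summable fun j => ‖c j‖ := by
    have := (h 1 (by simp)).summable.norm
    simpa using this
  have hterm : ∀ (j : ι) (θ : ℝ), c j * exp (θ * I) ^ k j * exp (-(m * θ * I)) =
      c j * exp (((k j - m : ℤ) : ℂ) * I * θ) := by
    intro j θ
    rw [mul_assoc, ← Complex.exp_int_mul, ← Complex.exp_add]
    congr 2; push_cast; ring
  have hnorm : ∀ (j : ι) (θ : ℝ), ‖c j * exp (θ * I) ^ k j * exp (-(m * θ * I))‖ = ‖c j‖ := by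
    intro j θ
    have : -(m * θ * I) = ((-(m * θ) : ℝ) : ℂ) * I := by push_cast; ring
    rw [norm_mul, norm_mul, norm_zpow, norm_exp_ofReal_mul_I, this, norm_exp_ofReal_mul_I]
    simp
  have h1 := intervalIntegral.hasSum_integral_of_dominated_convergence (μ := MeasureTheory.volume)
    (a := 0) (b := 2 * Real.pi)
    (F := fun j (θ : ℝ) => c j * exp (θ * I) ^ k j * exp (-(m * θ * I)))
    (f := fun θ : ℝ => φ (exp (θ * I)) * exp (-(m * θ * I)))
    (fun j _ => ‖c j‖)
    (fun j => by
      simp_rw [hterm]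
      exact (by fun_prop : Continuous fun θ : ℝ =>
        c j * exp (((k j - m : ℤ) : ℂ) * I * θ)).aestronglyMeasurable)
    (fun j => Filter.Eventually.of_forall fun θ _ => (hnorm j θ).le)
    (Filter.Eventually.of_forall fun _ _ => hc)
    (by simp)
    (Filter.Eventually.of_forall fun θ _ => (h _ (norm_exp_ofReal_mul_I θ)).mul_right _)
  have h2 := h1.mul_left (2 * Real.pi : ℂ)⁻¹
  unfold laurentCoeff
  convert! h2 using 2 with j
  have hpi : (Real.pi : ℂ) ≠ 0 := by exact_mod_cast Real.pi_ne_zero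
  simp_rw [hterm]
  rw [intervalIntegral.integral_const_mul]
  split_ifs with hj
  · subst hj
    simp
    field_simp
  · have hne : ((k j - m : ℤ) : ℂ) * I ≠ 0 :=
      mul_ne_zero (by exact_mod_cast sub_ne_zero.2 hj) I_ne_zero
    rw [integral_exp_mul_complex hne]
    have : ((k j - m : ℤ) : ℂ) * I * ((2 * Real.pi : ℝ) : ℂ) =
      ((k j - m : ℤ) : ℂ) * (2 * Real.pi * I) := by push_cast; ring
    rw [this, exp_int_mul_two_pi_mul_I]
    simp

lemma hasSum_laurentCoeff {ψ : ℂ → ℂ} (hψ : ContinuousOn ψ {0}ᶜ)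
    (hs : Summable (laurentCoeff ψ)) : HasSum (laurentCoeff ψ) (ψ 1) := by
  have : Fact (0 < 2 * Real.pi) := ⟨Real.two_pi_pos⟩
  let φ : C(AddCircle (2 * Real.pi), ℂ) :=
    ⟨fun θ => ψ (AddCircle.toCircle θ : ℂ), hψ.comp_continuous
      (continuous_subtype_val.comp AddCircle.continuous_toCircle) fun θ => by simp⟩
  have hφ : fourierCoeff φ = laurentCoeff ψ := by
    funext n
    rw [fourierCoeff_eq_intervalIntegral _ n 0, laurentCoeff, zero_add, Complex.real_smul]
    congr 1
    · push_cast; rw [one_div]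
    · refine intervalIntegral.integral_congr fun θ _ => ?_
      have hpi : (Real.pi : ℂ) ≠ 0 := by exact_mod_cast Real.pi_ne_zero
      have h1 : (AddCircle.toCircle (θ : AddCircle (2 * Real.pi)) : ℂ) = exp (θ * I) := by
        rw [AddCircle.toCircle_apply_mk, div_self Real.two_pi_pos.ne', one_mul, Circle.coe_exp]
      simp only [φ, ContinuousMap.coe_mk, h1, fourier_coe_apply, smul_eq_mul]
      rw [mul_comm]
      congr 2
      push_cast
      field_simp
  have := has_pointwise_sum_fourier_series_of_summable (f := φ) (hφ ▸ hs) 0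
  simp only [fourier_eval_zero, hφ, smul_eq_mul, mul_one] at this
  simpa [φ] using this

lemma differentiable_intervalIntegral_of_continuous {Φ : ℝ → ℂ → ℂ}
    (hc : Continuous (Function.uncurry Φ)) (hd : ∀ θ, Differentiable ℂ (Φ θ)) (a b : ℝ) :
    Differentiable ℂ fun t => ∫ θ in a..b, Φ θ t := by
  intro t₀
  obtain ⟨C, hC⟩ := ((isCompact_uIcc (a := a) (b := b)).prod
    (isCompact_closedBall t₀ 2)).exists_bound_of_continuousOn hc.continuousOn
  have hcθ : ∀ t, Continuous fun θ => Φ θ t := fun t =>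
    hc.comp (continuous_id.prodMk continuous_const)
  refine (intervalIntegral.hasDerivAt_integral_of_dominated_loc_of_deriv_le
    (F := fun t θ => Φ θ t) (F' := fun t θ => deriv (Φ θ) t) (bound := fun _ => C)
    (Metric.ball_mem_nhds t₀ one_pos)
    (Filter.Eventually.of_forall fun t => (hcθ t).aestronglyMeasurable)
    ((hcθ t₀).intervalIntegrable _ _)
    ((measurable_deriv_with_param hc).comp
      (measurable_id.prodMk measurable_const)).aestronglyMeasurable
    (Filter.Eventually.of_forall fun θ hθ t ht => ?_)
    (by simp)
    (Filter.Eventually.of_forall fun θ _ t _ => (hd θ t).hasDerivAt)).2.differentiableAt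
  have := norm_deriv_le_of_forall_mem_sphere_norm_le (c := t) (R := 1) (C := C) one_pos
    (hd θ).diffContOnCl fun z hz => hC (θ, z) ⟨Set.uIoc_subset_uIcc hθ, ?_⟩
  · simpa using this
  · have h1 : dist z t = 1 := hz
    have h2 : dist t t₀ < 1 := ht
    have := dist_triangle z t t₀
    exact Metric.mem_closedBall.2 (by linarith)

/-- Laurent–Taylor coefficients of a holomorphic function on `ℂˣ × ℂ`, in nonnegative Laurent
degrees. -/
lemma exists_laurent_taylor_coeff {F : ℂ × ℂ → ℂ} (hF : DifferentiableOn ℂ F {p | p.1 ≠ 0}) :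
    ∃ c : ℕ → ℕ → ℂ, (∀ R : ℝ, 0 < R → ∃ C, ∀ n k, ‖c n k‖ * R ^ (n + k) ≤ C) ∧
      ∀ x : ℂ, x ≠ 0 → ∀ (t : ℂ) (n : ℕ),
        HasSum (fun k => c n k * (x ^ n * t ^ k)) (laurentCoeff (fun ζ => F (ζ * x, t)) n) := by
  have hopen : IsOpen {p : ℂ × ℂ | p.1 ≠ 0} := isOpen_ne_fun continuous_fst continuous_const
  have hdiff : ∀ p : ℂ × ℂ, p.1 ≠ 0 → DifferentiableAt ℂ F p := fun p hp =>
    (hF p hp).differentiableAt (hopen.mem_nhds hp)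
  have hdx : ∀ t : ℂ, DifferentiableOn ℂ (fun ζ => F (ζ, t)) {0}ᶜ := fun t ζ hζ =>
    ((hdiff (ζ, t) hζ).comp ζ (by fun_prop :
      DifferentiableAt ℂ (fun ζ : ℂ => (ζ, t)) ζ)).differentiableWithinAt
  let H : ℕ → ℂ → ℂ := fun n t => laurentCoeff (fun ζ => F (ζ, t)) n
  have hH : ∀ n, Differentiable ℂ (H n) := by
    intro n
    refine (differentiable_intervalIntegral_of_continuous
      (Φ := fun θ t => F (exp (θ * I), t) * exp (-((n : ℤ) * θ * I))) ?_ ?_ 0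
        (2 * Real.pi)).const_mul _
    · refine Continuous.mul ?_ (by fun_prop)
      exact hF.continuousOn.comp_continuous (f := fun p : ℝ × ℂ => (exp (p.1 * I), p.2))
        (by fun_prop) fun p => exp_ne_zero _
    · intro θ t
      exact ((hdiff (exp (θ * I), t) (exp_ne_zero _)).comp t (by fun_prop :
        DifferentiableAt ℂ (fun t : ℂ => (exp (θ * I), t)) t)).mul_const _
  refine ⟨fun n k => (k.factorial : ℂ)⁻¹ * iteratedDeriv k (H n) 0, fun R hR => ?_,
    fun x hx t n => ?_⟩
  · obtain ⟨C, hC⟩ := ((isCompact_sphere (0 : ℂ) R).prod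
      (isCompact_sphere (0 : ℂ) R)).exists_bound_of_continuousOn
      (hF.continuousOn.mono fun p hp => by
        have h1 : ‖p.1‖ = R := by simpa using hp.1
        exact norm_pos_iff.1 (h1 ▸ hR))
    refine ⟨C, fun n k => ?_⟩
    have hRC : (R : ℂ) ≠ 0 := by exact_mod_cast hR.ne'
    have hb : ∀ t ∈ Metric.sphere (0 : ℂ) R, ‖H n t‖ ≤ C / R ^ n := by
      intro t ht
      have h1 := laurentCoeff_comp_mul (hdx t) n hRC
      have h2 : ‖laurentCoeff (fun ζ => F (ζ * R, t)) n‖ ≤ C :=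
        norm_laurentCoeff_le (fun ζ hζ => hC (ζ * R, t)
          ⟨by simp [hζ, abs_of_pos hR], ht⟩) n
      rw [h1, norm_mul, zpow_natCast, norm_pow, norm_real, Real.norm_of_nonneg hR.le] at h2
      rw [le_div_iff₀ (by positivity), mul_comm]
      exact h2
    have h3 := norm_iteratedDeriv_le_of_forall_mem_sphere_norm_le k hR (hH n).diffContOnCl hb
    have hk : (0 : ℝ) < k.factorial := by exact_mod_cast k.factorial_pos
    rw [norm_mul, norm_inv, Complex.norm_natCast]
    calc _ ≤ (k.factorial : ℝ)⁻¹ * (k.factorial * (C / R ^ n) / R ^ k) * R ^ (n + k) := by gcongr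
      _ = C := by rw [pow_add]; field_simp
  · rw [laurentCoeff_comp_mul (hdx t) n hx, zpow_natCast]
    have := (hasSum_taylorSeries_of_entire (hH n) 0 t).mul_left (x ^ n)
    convert! this using 2 with k
    simp only [sub_zero, smul_eq_mul]
    ring

/-- The monomial of the affine quadric `xy = t(1+t)` that corresponds to `fpq p q`. -/
noncomputable def quadricMonomial (p q : ℕ) (s : ℂ × ℂ × ℂ) : ℂ :=
  s.1 ^ (p - q) * s.2.1 ^ (q - p) * s.2.2 ^ min p q

/-- The coordinates `(x, y, t)` on the quadric in the standard chart. -/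
noncomputable def affineCoords (zw : ℂ × ℂ) : ℂ × ℂ × ℂ :=
  (zw.1 / (1 - zw.1 * zw.2), zw.2 / (1 - zw.1 * zw.2), zw.1 * zw.2 / (1 - zw.1 * zw.2))

/-- The coordinates `(x, y, t)` on the quadric in the flip chart. -/
noncomputable def flipCoords (uv : ℂ × ℂ) : ℂ × ℂ × ℂ :=
  (uv.1 / (uv.1 * uv.2 - 1), uv.2 / (uv.1 * uv.2 - 1), 1 / (uv.1 * uv.2 - 1))

lemma isOpen_Omega0 : IsOpen Omega0 :=
  isOpen_ne_fun (continuous_fst.mul continuous_snd) continuous_const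

lemma continuousOn_affineCoords : ContinuousOn affineCoords Omega0 := by
  have h : ∀ p ∈ Omega0, 1 - p.1 * p.2 ≠ 0 := fun p hp => sub_ne_zero.2 (Ne.symm hp)
  unfold affineCoords
  fun_prop (disch := assumption)

lemma continuousOn_flipCoords : ContinuousOn flipCoords Omega0 := by
  have h : ∀ p ∈ Omega0, p.1 * p.2 - 1 ≠ 0 := fun p hp => sub_ne_zero.2 hp
  unfold flipCoords
  fun_prop (disch := assumption)

lemma fpq_eq_quadricMonomial (p q : ℕ) (zw : ℂ × ℂ) :
    fpq p q zw = quadricMonomial p q (affineCoords zw) := by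
  unfold fpq quadricMonomial affineCoords
  rcases le_total q p with h | h
  · obtain ⟨k, rfl⟩ := Nat.exists_eq_add_of_le h
    simp only [le_add_iff_nonneg_right, zero_le, sup_of_le_left, inf_of_le_right,
      add_tsub_cancel_left, Nat.sub_eq_zero_of_le h, pow_zero, mul_one, div_pow, mul_pow]
    rw [div_mul_div_comm, ← pow_add, add_comm k q, pow_add]
    ring
  · obtain ⟨k, rfl⟩ := Nat.exists_eq_add_of_le h
    simp only [le_add_iff_nonneg_right, zero_le, sup_of_le_right, inf_of_le_left,
      add_tsub_cancel_left, Nat.sub_eq_zero_of_le h, pow_zero, one_mul, div_pow, mul_pow]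
    rw [div_mul_div_comm, ← pow_add, add_comm k p, pow_add]
    ring

lemma gpq_eq_quadricMonomial (p q : ℕ) (uv : ℂ × ℂ) :
    gpq p q uv = quadricMonomial p q (flipCoords uv) := by
  unfold gpq quadricMonomial flipCoords
  split_ifs with h
  · obtain ⟨k, rfl⟩ := Nat.exists_eq_add_of_le h
    simp only [le_add_iff_nonneg_right, zero_le, inf_of_le_right,
      add_tsub_cancel_left, Nat.sub_eq_zero_of_le h, pow_zero, mul_one, div_pow, one_pow]
    rw [div_mul_div_comm, ← pow_add, add_comm k q, mul_one]
  · obtain ⟨k, rfl⟩ := Nat.exists_eq_add_of_le (not_le.1 h).le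
    simp only [le_add_iff_nonneg_right, zero_le, inf_of_le_left,
      add_tsub_cancel_left, Nat.sub_eq_zero_of_le (not_le.1 h).le, pow_zero, one_mul, div_pow,
      one_pow]
    rw [div_mul_div_comm, ← pow_add, add_comm k p, mul_one]

lemma continuous_quadricMonomial (p q : ℕ) : Continuous (quadricMonomial p q) := by
  unfold quadricMonomial
  fun_prop

lemma norm_quadricMonomial_le {R : ℝ} {s : ℂ × ℂ × ℂ} (hs : ‖s‖ ≤ R) (p q : ℕ) :
    ‖quadricMonomial p q s‖ ≤ R ^ max p q := by
  have h1 : ‖s.1‖ ≤ R := (norm_fst_le s).trans hs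
  have h2 : ‖s.2.1‖ ≤ R := (norm_fst_le s.2).trans ((norm_snd_le s).trans hs)
  have h3 : ‖s.2.2‖ ≤ R := (norm_snd_le s.2).trans ((norm_snd_le s).trans hs)
  have hR : 0 ≤ R := (norm_nonneg s).trans hs
  unfold quadricMonomial
  rw [norm_mul, norm_mul, norm_pow, norm_pow, norm_pow]
  calc _ ≤ R ^ (p - q) * R ^ (q - p) * R ^ min p q := by gcongr
    _ = R ^ max p q := by rw [← pow_add, ← pow_add]; congr 1; omega

/-- Faster than geometric decay of a double family of coefficients. -/
def RapidDecay (a : ℕ → ℕ → ℂ) : Prop :=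
  ∀ R : ℝ, 0 < R → ∃ C, ∀ p q, ‖a p q‖ * R ^ max p q ≤ C

lemma RapidDecay.summable {a : ℕ → ℕ → ℂ} (ha : RapidDecay a) {R : ℝ} (hR : 0 < R) :
    Summable fun pq : ℕ × ℕ => ‖a pq.1 pq.2‖ * R ^ max pq.1 pq.2 := by
  obtain ⟨C, hC⟩ := ha (4 * R) (by positivity)
  have hC0 : 0 ≤ C := le_trans (by positivity) (hC 0 0)
  have hg : Summable fun pq : ℕ × ℕ => C * ((1 / 2 : ℝ) ^ pq.1 * (1 / 2) ^ pq.2) :=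
    (summable_geometric_two.mul_of_nonneg summable_geometric_two
      (fun _ => by positivity) (fun _ => by positivity)).mul_left C
  refine hg.of_nonneg_of_le (fun _ => by positivity) fun ⟨p, q⟩ => ?_
  have h1 : ‖a p q‖ * R ^ max p q = ‖a p q‖ * (4 * R) ^ max p q * (1 / 4) ^ max p q := by
    rw [mul_assoc, ← mul_pow]; congr 2; ring
  have h2 : (1 / 4 : ℝ) ^ max p q ≤ (1 / 2) ^ p * (1 / 2) ^ q := by
    have : (1 / 4 : ℝ) = (1 / 2) ^ 2 := by norm_num
    rw [this, ← pow_mul, ← pow_add]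
    exact pow_le_pow_of_le_one (by norm_num) (by norm_num) (by omega)
  simp only
  rw [h1]
  exact mul_le_mul (hC p q) h2 (by positivity) hC0

lemma exists_pos_norm_le_of_isCompact {X E : Type*} [TopologicalSpace X] [SeminormedAddGroup E]
    {K : Set X} (hK : IsCompact K) {φ : X → E} (hφ : ContinuousOn φ K) :
    ∃ R : ℝ, 0 < R ∧ ∀ x ∈ K, ‖φ x‖ ≤ R := by
  obtain ⟨C, hC⟩ := hK.exists_bound_of_continuousOn hφ
  exact ⟨max C 1, by positivity, fun x hx => (hC x hx).trans (le_max_left _ _)⟩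

lemma RapidDecay.summable_iSup {X : Type*} [TopologicalSpace X] {a : ℕ → ℕ → ℂ}
    (ha : RapidDecay a) {K : Set X} (hK : IsCompact K) {φ : X → ℂ × ℂ × ℂ}
    (hφ : ContinuousOn φ K) :
    Summable fun pq : ℕ × ℕ =>
      ‖a pq.1 pq.2‖ * ⨆ x : K, ‖quadricMonomial pq.1 pq.2 (φ x)‖ := by
  obtain ⟨R, hR, hb⟩ := exists_pos_norm_le_of_isCompact hK hφ
  refine (ha.summable hR).of_nonneg_of_le
    (fun _ => mul_nonneg (norm_nonneg _) (Real.iSup_nonneg fun _ => norm_nonneg _))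
    fun pq => mul_le_mul_of_nonneg_left ?_ (norm_nonneg _)
  exact Real.iSup_le (fun x => norm_quadricMonomial_le (hb x x.2) _ _) (by positivity)

lemma RapidDecay.summable_eval {a : ℕ → ℕ → ℂ} (ha : RapidDecay a) (s : ℂ × ℂ × ℂ) :
    Summable fun pq : ℕ × ℕ => a pq.1 pq.2 * quadricMonomial pq.1 pq.2 s := by
  refine Summable.of_norm_bounded (ha.summable (R := ‖s‖ + 1) (by positivity)) fun pq => ?_
  rw [norm_mul]
  exact mul_le_mul_of_nonneg_left (norm_quadricMonomial_le (by linarith) _ _) (norm_nonneg _)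

lemma RapidDecay.continuous_tsum {a : ℕ → ℕ → ℂ} (ha : RapidDecay a) :
    Continuous fun s => ∑' pq : ℕ × ℕ, a pq.1 pq.2 * quadricMonomial pq.1 pq.2 s := by
  rw [continuous_iff_continuousAt]
  intro s₀
  refine (continuousOn_tsum (s := Metric.ball 0 (‖s₀‖ + 1))
    (fun pq => ((continuous_quadricMonomial _ _).const_mul _).continuousOn)
    (ha.summable (R := ‖s₀‖ + 1) (by positivity)) fun pq s hs => ?_).continuousAt
    (Metric.isOpen_ball.mem_nhds (by simp))
  rw [norm_mul]
  exact mul_le_mul_of_nonneg_left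
    (norm_quadricMonomial_le (mem_ball_zero_iff.1 hs).le _ _) (norm_nonneg _)

/-- An expansion valid off the coordinate axes extends to all of `Omega0`. -/
lemma RapidDecay.hasSum_of_ne_zero {a : ℕ → ℕ → ℂ} (ha : RapidDecay a) {h : ℂ × ℂ → ℂ}
    {φ : ℂ × ℂ → ℂ × ℂ × ℂ} (hh : ContinuousOn h Omega0) (hφ : ContinuousOn φ Omega0)
    (hsum : ∀ p ∈ Omega0, p.1 ≠ 0 → p.2 ≠ 0 →
      HasSum (fun pq : ℕ × ℕ => a pq.1 pq.2 * quadricMonomial pq.1 pq.2 (φ p)) (h p)) :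
    ∀ p ∈ Omega0,
      HasSum (fun pq : ℕ × ℕ => a pq.1 pq.2 * quadricMonomial pq.1 pq.2 (φ p)) (h p) := by
  have hdense : Dense (({0}ᶜ : Set ℂ) ×ˢ ({0}ᶜ : Set ℂ)) :=
    (dense_compl_singleton 0).prod (dense_compl_singleton 0)
  have heq : Set.EqOn (fun p => ∑' pq : ℕ × ℕ, a pq.1 pq.2 * quadricMonomial pq.1 pq.2 (φ p)) h
      Omega0 := by
    refine Set.EqOn.of_subset_closure (s := Omega0 ∩ ({0}ᶜ : Set ℂ) ×ˢ ({0}ᶜ : Set ℂ))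
      (fun p hp => (hsum p hp.1 hp.2.1 hp.2.2).tsum_eq)
      (ha.continuous_tsum.comp_continuousOn hφ) hh Set.inter_subset_left
      (hdense.open_subset_closure_inter isOpen_Omega0)
  intro p hp
  rw [← heq hp]
  exact (ha.summable_eval (φ p)).hasSum

/-- The function on the part `x ≠ 0` of the quadric, in the coordinates `(x, t)`, determined by
its two chart representatives. -/
noncomputable def glue (f g : ℂ × ℂ → ℂ) (s : ℂ × ℂ) : ℂ :=
  if 1 + s.2 = 0 then g (s.1 / s.2, (1 + s.2) / s.1) else f (s.1 / (1 + s.2), s.2 / s.1)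

lemma glue_eq_left (f g : ℂ × ℂ → ℂ) {s : ℂ × ℂ} (h : 1 + s.2 ≠ 0) :
    glue f g s = f (s.1 / (1 + s.2), s.2 / s.1) := if_neg h

lemma glue_eq_right {f g : ℂ × ℂ → ℂ}
    (hfg : ∀ u v : ℂ, u ≠ 0 → v ≠ 0 → u * v ≠ 1 → g (u, v) = f (1 / v, 1 / u))
    {s : ℂ × ℂ} (h1 : s.1 ≠ 0) (h2 : s.2 ≠ 0) :
    glue f g s = g (s.1 / s.2, (1 + s.2) / s.1) := by
  unfold glue
  split_ifs with h
  · rfl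
  · rw [hfg _ _ (div_ne_zero h1 h2) (div_ne_zero h h1), one_div_div, one_div_div]
    rw [div_mul_div_cancel₀' h1, ne_eq, div_eq_one_iff_eq h2]
    simp

lemma differentiableOn_glue {f g : ℂ × ℂ → ℂ}
    (hf : DifferentiableOn ℂ f Omega0) (hg : DifferentiableOn ℂ g Omega0)
    (hfg : ∀ u v : ℂ, u ≠ 0 → v ≠ 0 → u * v ≠ 1 → g (u, v) = f (1 / v, 1 / u)) :
    DifferentiableOn ℂ (glue f g) {s | s.1 ≠ 0} := by
  intro s hs
  have hs1 : s.1 ≠ 0 := hs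
  refine DifferentiableAt.differentiableWithinAt ?_
  by_cases h : 1 + s.2 = 0
  · have h2 : s.2 ≠ 0 := by
      intro h0
      simp [h0] at h
    have hmem : (s.1 / s.2, (1 + s.2) / s.1) ∈ Omega0 := by
      simp [Omega0, h]
    have hd : DifferentiableAt ℂ (fun s : ℂ × ℂ => g (s.1 / s.2, (1 + s.2) / s.1)) s :=
      ((hg _ hmem).differentiableAt (isOpen_Omega0.mem_nhds hmem)).comp s
        (by fun_prop (disch := assumption))
    refine hd.congr_of_eventuallyEq ?_
    filter_upwards [(isOpen_ne_fun continuous_fst continuous_const).mem_nhds hs1,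
      (isOpen_ne_fun continuous_snd continuous_const).mem_nhds h2] with s h1 h2
    exact glue_eq_right hfg h1 h2
  · have hmem : (s.1 / (1 + s.2), s.2 / s.1) ∈ Omega0 := by
      simp only [Omega0, Set.mem_ofPred_eq]
      rw [mul_comm, div_mul_div_cancel₀ hs1, ne_eq, div_eq_one_iff_eq h]
      simp
    have hd : DifferentiableAt ℂ (fun s : ℂ × ℂ => f (s.1 / (1 + s.2), s.2 / s.1)) s :=
      ((hf _ hmem).differentiableAt (isOpen_Omega0.mem_nhds hmem)).comp s
        (by fun_prop (disch := assumption))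
    refine hd.congr_of_eventuallyEq ?_
    filter_upwards [(isOpen_ne_fun (f := fun s : ℂ × ℂ => 1 + s.2) (by fun_prop)
      continuous_const).mem_nhds h] with s h1
    exact glue_eq_left f g h1

lemma glue_affineCoords (f g : ℂ × ℂ → ℂ) {z w ζ : ℂ} (hz : z ≠ 0) (hζ : ζ ≠ 0)
    (h : z * w ≠ 1) :
    glue f g (ζ * (z / (1 - z * w)), z * w / (1 - z * w)) = f (ζ * z, w / ζ) := by
  have h1 : 1 - z * w ≠ 0 := sub_ne_zero.2 h.symm
  have h2 : 1 + z * w / (1 - z * w) = 1 / (1 - z * w) := by field_simp; ring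
  rw [glue_eq_left _ _ (by simpa [h2] using h1)]
  simp only [h2]
  congr 2 <;> field_simp

lemma exists_rapidDecay_expansion {f g : ℂ × ℂ → ℂ}
    (hf : DifferentiableOn ℂ f Omega0) (hg : DifferentiableOn ℂ g Omega0)
    (hfg : ∀ u v : ℂ, u ≠ 0 → v ≠ 0 → u * v ≠ 1 → g (u, v) = f (1 / v, 1 / u)) :
    ∃ c : ℕ → ℕ → ℂ, (∀ R : ℝ, 0 < R → ∃ C, ∀ n k, ‖c n k‖ * R ^ (n + k) ≤ C) ∧
      ∀ z w : ℂ, z ≠ 0 → z * w ≠ 1 → ∀ n : ℕ,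
        HasSum (fun k => c n k * ((z / (1 - z * w)) ^ n * (z * w / (1 - z * w)) ^ k))
          (laurentCoeff (fun ζ => f (ζ * z, w / ζ)) n) := by
  obtain ⟨c, hc, hsum⟩ := exists_laurent_taylor_coeff (differentiableOn_glue hf hg hfg)
  refine ⟨c, hc, fun z w hz hzw n => ?_⟩
  have h1 : 1 - z * w ≠ 0 := sub_ne_zero.2 hzw.symm
  rw [laurentCoeff_congr (ψ := fun ζ => glue f g (ζ * (z / (1 - z * w)), z * w / (1 - z * w)))
    fun ζ hζ => (glue_affineCoords f g hz (norm_ne_zero_iff.1 (by simp [hζ])) hzw).symm]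
  exact hsum _ (div_ne_zero hz h1) _ n

/-- Pairs of naturals, parametrized by their difference and their minimum. -/
def diffMinEquiv : ℤ × ℕ ≃ ℕ × ℕ where
  toFun nk := (nk.2 + nk.1.toNat, nk.2 + (-nk.1).toNat)
  invFun pq := ((pq.1 : ℤ) - pq.2, min pq.1 pq.2)
  left_inv := by
    rintro ⟨n, k⟩
    ext <;> simp only <;> omega
  right_inv := by
    rintro ⟨p, q⟩
    ext <;> simp only <;> omega

lemma differentiableOn_comp_swap {f : ℂ × ℂ → ℂ} (hf : DifferentiableOn ℂ f Omega0) :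
    DifferentiableOn ℂ (fun p => f p.swap) Omega0 :=
  hf.comp (f := Prod.swap)
    (differentiable_snd.prodMk differentiable_fst).differentiableOn
    fun p hp => by simpa [Omega0, mul_comm] using hp

lemma exists_expansion {f g : ℂ × ℂ → ℂ}
    (hf : DifferentiableOn ℂ f Omega0) (hg : DifferentiableOn ℂ g Omega0)
    (hfg : ∀ u v : ℂ, u ≠ 0 → v ≠ 0 → u * v ≠ 1 → g (u, v) = f (1 / v, 1 / u)) :
    ∃ a : ℕ → ℕ → ℂ, RapidDecay a ∧ ∀ p ∈ Omega0, p.1 ≠ 0 → p.2 ≠ 0 →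
      HasSum (fun pq : ℕ × ℕ => a pq.1 pq.2 * quadricMonomial pq.1 pq.2 (affineCoords p))
        (f p) := by
  obtain ⟨c, hc, hcs⟩ := exists_rapidDecay_expansion hf hg hfg
  obtain ⟨d, hd, hds⟩ := exists_rapidDecay_expansion (differentiableOn_comp_swap hf)
    (differentiableOn_comp_swap hg)
    (fun u v hu hv huv => hfg v u hv hu (by rwa [mul_comm]))
  let a : ℕ → ℕ → ℂ := fun p q => if q ≤ p then c (p - q) q else d (q - p) p
  have ha : RapidDecay a := by
    intro R hR
    obtain ⟨C, hC⟩ := hc R hR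
    obtain ⟨D, hD⟩ := hd R hR
    refine ⟨max C D, fun p q => ?_⟩
    by_cases h : q ≤ p
    · have := hC (p - q) q
      rw [Nat.sub_add_cancel h] at this
      simp only [a, if_pos h, max_eq_left h]
      exact this.trans (le_max_left _ _)
    · have := hD (q - p) p
      rw [Nat.sub_add_cancel (not_le.1 h).le] at this
      simp only [a, if_neg h, max_eq_right (not_le.1 h).le]
      exact this.trans (le_max_right _ _)
  refine ⟨a, ha, ?_⟩
  rintro ⟨z, w⟩ hzw hz hw
  simp only at hz hw
  have hzw' : z * w ≠ 1 := hzw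
  let ψ : ℂ → ℂ := fun ζ => f (ζ * z, w / ζ)
  have hψ : ContinuousOn ψ {0}ᶜ := by
    have hψ0 : ∀ ζ ∈ ({0}ᶜ : Set ℂ), ζ ≠ 0 := fun ζ hζ => hζ
    refine hf.continuousOn.comp (f := fun ζ : ℂ => (ζ * z, w / ζ))
      (by fun_prop (disch := assumption)) fun ζ hζ => ?_
    have : ζ * z * (w / ζ) = z * w := by
      have := hψ0 ζ hζ
      field_simp
    simpa [Omega0, this] using hzw'
  have hs := diffMinEquiv.hasSum_iff.2 (ha.summable_eval (affineCoords (z, w))).hasSum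
  have hfib : ∀ n : ℤ, HasSum (fun k : ℕ => ((fun pq : ℕ × ℕ => a pq.1 pq.2 *
      quadricMonomial pq.1 pq.2 (affineCoords (z, w))) ∘ diffMinEquiv) (n, k))
      (laurentCoeff ψ n) := by
    intro n
    obtain ⟨m, rfl | rfl⟩ := n.eq_nat_or_neg
    · convert! hcs z w hz hzw' m using 2 with k
      simp [diffMinEquiv, a, quadricMonomial, affineCoords]
    · rcases Nat.eq_zero_or_pos m with rfl | hm
      · convert! hcs z w hz hzw' 0 using 2 with k
        simp [diffMinEquiv, a, quadricMonomial, affineCoords]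
      · rw [← laurentCoeff_comp_inv]
        convert! hds w z hw (by rwa [mul_comm]) m using 2 with k
        · have hk : ¬ (k + m ≤ k) := by omega
          simp [diffMinEquiv, a, quadricMonomial, affineCoords, mul_comm w z, hk]
        · funext ζ
          simp [ψ, div_eq_mul_inv, mul_comm]
  have hL := hs.prod_fiberwise hfib
  have h1 := hL.unique (hasSum_laurentCoeff hψ hL.summable)
  have h2 : ψ 1 = f (z, w) := by simp [ψ]
  rw [← h2, ← h1]
  exact (ha.summable_eval (affineCoords (z, w))).hasSum

lemma coeff_eq_zero_of_hasSum_zero {c : ℕ → ℂ}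
    (h : ∀ t : ℂ, 1 + t ≠ 0 → HasSum (fun k => c k * t ^ k) 0) (k : ℕ) : c k = 0 := by
  have h1 : HasFPowerSeriesAt (0 : ℂ → ℂ) (FormalMultilinearSeries.ofScalars ℂ c) 0 := by
    rw [hasFPowerSeriesAt_iff]
    have : ∀ᶠ t : ℂ in nhds 0, 1 + t ≠ 0 :=
      ContinuousAt.eventually_ne (by fun_prop) (by simp)
    filter_upwards [this] with t ht
    simpa [FormalMultilinearSeries.coeff_ofScalars, mul_comm] using h t ht
  have h2 := congrArg (fun p => FormalMultilinearSeries.coeff p k) h1.eq_zero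
  have h3 : (0 : FormalMultilinearSeries ℂ ℂ ℂ).coeff k = 0 := by
    simp [FormalMultilinearSeries.coeff]
  simpa [FormalMultilinearSeries.coeff_ofScalars, h3] using h2

lemma eq_zero_of_hasSum_zero_of_le {b : ℕ → ℕ → ℂ}
    (h : ∀ zw ∈ Omega0, HasSum (fun pq : ℕ × ℕ => b pq.1 pq.2 * fpq pq.1 pq.2 zw) 0) (m q : ℕ) :
    b (m + q) q = 0 := by
  refine coeff_eq_zero_of_hasSum_zero (c := fun q => b (m + q) q) (fun t ht => ?_) q
  have hlc : laurentCoeff (fun _ => 0) m = 0 := by simp [laurentCoeff]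
  have h1 := hasSum_laurentCoeff_of_hasSum (φ := fun _ => 0)
    (fun pq : ℕ × ℕ => b pq.1 pq.2 * fpq pq.1 pq.2 (1 / (1 + t), t))
    (fun pq => (pq.1 : ℤ) - pq.2) (fun ζ hζ => ?_) m
  · rw [hlc] at h1
    have hinj : Function.Injective fun q : ℕ => (m + q, q) := fun q q' hq => (Prod.ext_iff.1 hq).2
    rw [← hinj.hasSum_iff] at h1
    · convert! h1 using 2 with k
      have h3 : 1 - 1 / (1 + t) * t = 1 / (1 + t) := by field_simp; ring
      simp only [Function.comp_apply, Nat.cast_add, add_sub_cancel_right, if_true, fpq, h3]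
      rw [max_eq_left (Nat.le_add_left k m)]
      field_simp
    · rintro ⟨p, q⟩ hpq
      refine if_neg fun hm => hpq ⟨q, ?_⟩
      simp only at hm
      ext <;> simp only
      omega
  · have hζ0 : ζ ≠ 0 := norm_ne_zero_iff.1 (by simp [hζ])
    have hprod : ζ * (1 / (1 + t)) * (t / ζ) = 1 / (1 + t) * t := by field_simp
    have hmem : (ζ * (1 / (1 + t)), t / ζ) ∈ Omega0 := by
      simp only [Omega0, Set.mem_ofPred_eq, hprod]
      rw [one_div_mul_eq_div, ne_eq, div_eq_one_iff_eq ht]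
      simp
    convert! h _ hmem using 2 with pq
    simp only [fpq, hprod]
    rw [zpow_sub₀ hζ0, mul_pow, div_pow t ζ, zpow_natCast, zpow_natCast]
    field_simp

lemma eq_zero_of_hasSum_zero {b : ℕ → ℕ → ℂ}
    (h : ∀ zw ∈ Omega0, HasSum (fun pq : ℕ × ℕ => b pq.1 pq.2 * fpq pq.1 pq.2 zw) 0) (p q : ℕ) :
    b p q = 0 := by
  rcases le_total q p with hpq | hpq
  · have := eq_zero_of_hasSum_zero_of_le h (p - q) q
    rwa [Nat.sub_add_cancel hpq] at this
  · have := eq_zero_of_hasSum_zero_of_le (b := fun p q => b q p) (fun zw hzw => ?_) (q - p) p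
    · rwa [Nat.sub_add_cancel hpq] at this
    · have h1 := (Equiv.prodComm ℕ ℕ).hasSum_iff.2
        (h zw.swap (by simpa [Omega0, mul_comm] using hzw))
      convert! h1 using 2 with pq
      simp only [Function.comp_apply, Equiv.prodComm_apply, fpq, Prod.fst_swap, Prod.snd_swap,
        max_comm pq.1 pq.2, mul_comm]

/-- Schauder expansion (chart version). For a pair (f,g) of holomorphic
functions on Ω₀ with g(u,v) = f(1/v, 1/u), there is a unique coefficient family
(a_{p,q}) with locally absolutely convergent expansions f = Σ a_{p,q} f_{p,q} and
g = Σ a_{p,q} g_{p,q}. -/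
theorem schauder_expansion
    (f g : ℂ × ℂ → ℂ)
    (hf : DifferentiableOn ℂ f Omega0) (hg : DifferentiableOn ℂ g Omega0)
    (hfg : ∀ u v : ℂ, u ≠ 0 → v ≠ 0 → u * v ≠ 1 → g (u, v) = f (1 / v, 1 / u)) :
    ∃! a : ℕ → ℕ → ℂ,
      (∀ K : Set (ℂ × ℂ), IsCompact K → K ⊆ Omega0 →
        Summable (fun pq : ℕ × ℕ =>
          ‖a pq.1 pq.2‖ * ⨆ zw : K, ‖fpq pq.1 pq.2 (zw : ℂ × ℂ)‖) ∧
        Summable (fun pq : ℕ × ℕ =>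
          ‖a pq.1 pq.2‖ * ⨆ uv : K, ‖gpq pq.1 pq.2 (uv : ℂ × ℂ)‖)) ∧
      (∀ zw ∈ Omega0, HasSum (fun pq : ℕ × ℕ => a pq.1 pq.2 * fpq pq.1 pq.2 zw) (f zw)) ∧
      (∀ uv ∈ Omega0, HasSum (fun pq : ℕ × ℕ => a pq.1 pq.2 * gpq pq.1 pq.2 uv) (g uv)) := by
  obtain ⟨a, ha, hsum⟩ := exists_expansion hf hg hfg
  refine ⟨a, ⟨fun K hK hKΩ => ⟨?_, ?_⟩, ?_, ?_⟩, ?_⟩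
  · simp_rw [fpq_eq_quadricMonomial]
    exact ha.summable_iSup hK (continuousOn_affineCoords.mono hKΩ)
  · simp_rw [gpq_eq_quadricMonomial]
    exact ha.summable_iSup hK (continuousOn_flipCoords.mono hKΩ)
  · simp_rw [fpq_eq_quadricMonomial]
    exact ha.hasSum_of_ne_zero hf.continuousOn continuousOn_affineCoords hsum
  · simp_rw [gpq_eq_quadricMonomial]
    refine ha.hasSum_of_ne_zero hg.continuousOn continuousOn_flipCoords ?_
    rintro ⟨u, v⟩ huv hu hv
    have huv' : u * v ≠ 1 := huv
    simp only at hu hv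
    have hmem : (1 / v, 1 / u) ∈ Omega0 := by
      simp only [Omega0, Set.mem_ofPred_eq]
      rwa [one_div_mul_one_div, mul_comm, ne_eq, one_div, inv_eq_one]
    have hcoord : flipCoords (u, v) = affineCoords (1 / v, 1 / u) := by
      have h1 : u * v - 1 ≠ 0 := sub_ne_zero.2 huv'
      have h2 : 1 - 1 / v * (1 / u) = (u * v - 1) / (u * v) := by field_simp
      simp only [flipCoords, affineCoords, h2]
      refine Prod.ext ?_ (Prod.ext ?_ ?_) <;> simp only <;> field_simp
    rw [hfg u v hu hv huv', hcoord]
    exact hsum _ hmem (one_div_ne_zero hv) (one_div_ne_zero hu)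
  · rintro a' ⟨-, hf', -⟩
    funext p q
    rw [← sub_eq_zero]
    refine eq_zero_of_hasSum_zero (b := fun p q => a' p q - a p q) (fun zw hzw => ?_) p q
    have h1 := ha.hasSum_of_ne_zero hf.continuousOn continuousOn_affineCoords hsum zw hzw
    simp_rw [← fpq_eq_quadricMonomial] at h1
    simpa [sub_mul] using (hf' zw hzw).sub h1
end

section
/- Let f, g : Ω₀ → ℂ be holomorphic functions on Ω₀ = {(z,w) ∈ ℂ × ℂ : z·w ≠ 1} satisfying g(u,v) = f(1/v, 1/u) for all u,v ∈ ℂ∖{0} with uv ≠ 1. Then there exist unique entire functions F⁺, F⁻ : ℂ² → ℂ such that the Taylor coefficients of F⁺ at the origin vanish on indices (p,q) with p < q, the Taylor coefficients of F⁻ vanish on indices with p ≥ q, and f(z,w) = F⁺(z/(1−zw), w) + F⁻(z, w/(1−zw)) for all (z,w) ∈ Ω₀. -/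
open Complex

/-- The sum of a double power series that converges everywhere is entire. -/
theorem differentiable_of_hasSum_double {a : ℕ → ℕ → ℂ} {F : ℂ × ℂ → ℂ}
    (hF : ∀ u v : ℂ, HasSum (fun pq : ℕ × ℕ => a pq.1 pq.2 * u ^ pq.1 * v ^ pq.2) (F (u, v))) :
    Differentiable ℂ F := by
  have hFt : F = fun x : ℂ × ℂ => ∑' pq : ℕ × ℕ, a pq.1 pq.2 * x.1 ^ pq.1 * x.2 ^ pq.2 :=
    funext fun x => (hF x.1 x.2).tsum_eq.symm
  intro x
  obtain ⟨R, hR1, hxR⟩ : ∃ R : ℝ, 1 ≤ R ∧ ‖x‖ < R := ⟨‖x‖ + 1, by simp, by simp⟩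
  have hR0 : 0 < R := by linarith
  let f : ℕ × ℕ → ℂ × ℂ → ℂ := fun pq y => a pq.1 pq.2 * y.1 ^ pq.1 * y.2 ^ pq.2
  let f' : ℕ × ℕ → ℂ × ℂ → (ℂ × ℂ →L[ℂ] ℂ) := fun pq y =>
    (a pq.1 pq.2 * y.1 ^ pq.1) • ((pq.2 * y.2 ^ (pq.2 - 1)) • ContinuousLinearMap.snd ℂ ℂ ℂ) +
      y.2 ^ pq.2 • (a pq.1 pq.2 • ((pq.1 * y.1 ^ (pq.1 - 1)) • ContinuousLinearMap.fst ℂ ℂ ℂ))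
  have hu : Summable fun pq : ℕ × ℕ => ‖a pq.1 pq.2‖ * ((2 * R) ^ pq.1 * (2 * R) ^ pq.2) := by
    refine (hF (2 * R : ℝ) (2 * R : ℝ)).summable.norm.congr fun pq => ?_
    have h2R : ‖((2 * R : ℝ) : ℂ)‖ = 2 * R := by
      rw [Complex.norm_real, Real.norm_of_nonneg (by linarith)]
    simp only [norm_mul, norm_pow, h2R, mul_assoc]
  have hf : ∀ pq, ∀ y ∈ Metric.ball (0 : ℂ × ℂ) R, HasFDerivAt (f pq) (f' pq y) y := by
    intro pq y _
    have h1 : HasFDerivAt (fun y : ℂ × ℂ => y.1 ^ pq.1)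
        ((pq.1 * y.1 ^ (pq.1 - 1)) • ContinuousLinearMap.fst ℂ ℂ ℂ) y :=
      (hasDerivAt_pow pq.1 y.1).comp_hasFDerivAt y hasFDerivAt_fst
    have h2 : HasFDerivAt (fun y : ℂ × ℂ => y.2 ^ pq.2)
        ((pq.2 * y.2 ^ (pq.2 - 1)) • ContinuousLinearMap.snd ℂ ℂ ℂ) y :=
      (hasDerivAt_pow pq.2 y.2).comp_hasFDerivAt y hasFDerivAt_snd
    exact (h1.const_mul (a pq.1 pq.2)).mul h2
  have hmono : ∀ (n : ℕ) (z : ℂ), ‖z‖ ≤ R → ‖(n * z ^ (n - 1) : ℂ)‖ ≤ n * R ^ n := by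
    intro n z hz
    rw [norm_mul, norm_pow, Complex.norm_natCast]
    have : ‖z‖ ^ (n - 1) ≤ R ^ n :=
      (pow_le_pow_left₀ (norm_nonneg _) hz _).trans (pow_le_pow_right₀ hR1 (Nat.sub_le _ _))
    gcongr
  have hf' : ∀ pq, ∀ y ∈ Metric.ball (0 : ℂ × ℂ) R,
      ‖f' pq y‖ ≤ ‖a pq.1 pq.2‖ * ((2 * R) ^ pq.1 * (2 * R) ^ pq.2) := by
    rintro ⟨p, q⟩ y hy
    rw [mem_ball_zero_iff] at hy
    have hy1 : ‖y.1‖ ≤ R := (norm_fst_le y).trans hy.le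
    have hy2 : ‖y.2‖ ≤ R := (norm_snd_le y).trans hy.le
    have e1 : ‖y.1‖ ^ p ≤ R ^ p := pow_le_pow_left₀ (norm_nonneg _) hy1 _
    have e2 : ‖y.2‖ ^ q ≤ R ^ q := pow_le_pow_left₀ (norm_nonneg _) hy2 _
    have d1 := hmono p y.1 hy1
    have d2 := hmono q y.2 hy2
    have s1 : ‖ContinuousLinearMap.fst ℂ ℂ ℂ‖ ≤ 1 := ContinuousLinearMap.norm_fst_le ..
    have s2 : ‖ContinuousLinearMap.snd ℂ ℂ ℂ‖ ≤ 1 := ContinuousLinearMap.norm_snd_le ..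
    have hpq : (p + q : ℝ) ≤ 2 ^ p * 2 ^ q := by
      rw [← pow_add]
      exact_mod_cast (Nat.lt_two_pow_self (n := p + q)).le
    calc ‖f' (p, q) y‖
        ≤ ‖a p q‖ * ‖y.1‖ ^ p * (‖(q * y.2 ^ (q - 1) : ℂ)‖ * ‖ContinuousLinearMap.snd ℂ ℂ ℂ‖) +
          ‖y.2‖ ^ q * (‖a p q‖ *
            (‖(p * y.1 ^ (p - 1) : ℂ)‖ * ‖ContinuousLinearMap.fst ℂ ℂ ℂ‖)) := by
          refine (norm_add_le _ _).trans (le_of_eq ?_)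
          simp only [norm_smul, norm_mul, norm_pow]
      _ ≤ ‖a p q‖ * R ^ p * (q * R ^ q * 1) + R ^ q * (‖a p q‖ * (p * R ^ p * 1)) := by
          gcongr
      _ = ‖a p q‖ * R ^ p * R ^ q * (p + q) := by ring
      _ ≤ ‖a p q‖ * R ^ p * R ^ q * (2 ^ p * 2 ^ q) := by gcongr
      _ = _ := by simp only [mul_pow]; ring
  rw [hFt]
  exact (hasFDerivAt_tsum_of_isPreconnected hu Metric.isOpen_ball
    (convex_ball (0 : ℂ × ℂ) R).isPreconnected hf hf' (Metric.mem_ball_self hR0)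
    (hF 0 0).summable (by simpa using hxR)).differentiableAt

/-- A Taylor coefficient in the first variable of an entire function of two variables is an
entire function of the second variable. -/
theorem differentiable_iteratedDeriv_fst {A : ℂ × ℂ → ℂ} (hA : Differentiable ℂ A) (p : ℕ) :
    Differentiable ℂ fun w => iteratedDeriv p (fun u => A (u, w)) 0 := by
  have key : ∀ w, iteratedDeriv p (fun u => A (u, w)) 0 = (2 * Real.pi * I / p.factorial)⁻¹ *
      ∮ z in C(0, 1), (1 / (z - 0) ^ (p + 1)) • A (z, w) := by
    intro w
    have hd : Differentiable ℂ fun u => A (u, w) := by fun_prop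
    rw [hd.differentiableOn.circleIntegral_one_div_sub_center_pow_smul one_pos p, smul_eq_mul,
      inv_mul_cancel_left₀]
    exact div_ne_zero two_pi_I_ne_zero (by exact_mod_cast p.factorial_ne_zero)
  simp_rw [key]
  refine Differentiable.const_mul (fun w₀ => ?_) _
  obtain ⟨M, hM⟩ : ∃ M, ∀ y ∈ Metric.closedBall (0 : ℂ) 1 ×ˢ Metric.closedBall w₀ 2, ‖A y‖ ≤ M :=
    ((isCompact_closedBall _ _).prod (isCompact_closedBall _ _)).exists_bound_of_continuousOn
      hA.continuous.continuousOn
  have hAw : ∀ z, Differentiable ℂ fun w => A (z, w) := fun z => by fun_prop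
  let K : ℝ → ℂ := fun θ => deriv (circleMap 0 1) θ * (1 / (circleMap 0 1 θ - 0) ^ (p + 1))
  have hK : Continuous K := by
    simp only [K, deriv_circleMap, sub_zero]
    refine ((continuous_circleMap 0 1).mul continuous_const).mul
      (continuous_const.div₀ ((continuous_circleMap 0 1).pow _) fun θ => ?_)
    exact pow_ne_zero _ (circleMap_ne_center one_ne_zero)
  have hK1 : ∀ θ, ‖K θ‖ = 1 := fun θ => by simp [K]
  have hint : (fun w => ∮ z in C(0, 1), (1 / (z - 0) ^ (p + 1)) • A (z, w)) =
      fun w => ∫ θ in 0..2 * Real.pi, K θ * A (circleMap 0 1 θ, w) := by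
    simp only [circleIntegral, smul_eq_mul, ← mul_assoc, K]
  rw [hint]
  have hcont : ∀ w, Continuous fun θ : ℝ => K θ * A (circleMap 0 1 θ, w) := fun w =>
    hK.mul (hA.continuous.comp ((continuous_circleMap 0 1).prodMk continuous_const))
  have hmeas : Measurable fun θ : ℝ => deriv (fun w => A (circleMap 0 1 θ, w)) w₀ := by
    have h : Measurable fun y : ℝ × ℂ => deriv (fun w => A (circleMap 0 1 y.1, w)) y.2 :=
      measurable_deriv_with_param (f := fun (θ : ℝ) w => A (circleMap 0 1 θ, w))
        (hA.continuous.comp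
          (((continuous_circleMap 0 1).comp continuous_fst).prodMk continuous_snd))
    have h' : Measurable fun θ : ℝ => (θ, w₀) := measurable_id.prodMk measurable_const
    have h'' := h.comp h'
    simpa only [Function.comp_def] using h''
  refine (intervalIntegral.hasDerivAt_integral_of_dominated_loc_of_deriv_le
    (bound := fun _ => M) (F := fun w θ => K θ * A (circleMap 0 1 θ, w))
    (F' := fun w θ => K θ * deriv (fun w => A (circleMap 0 1 θ, w)) w)
    (Metric.ball_mem_nhds w₀ one_pos) (.of_forall fun w => (hcont w).aestronglyMeasurable)
    ((hcont w₀).intervalIntegrable _ _) (hK.measurable.mul hmeas).aestronglyMeasurable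
    (.of_forall fun θ _ w hw => ?_) (by simp)
    (.of_forall fun θ _ w _ => ?_)).2.differentiableAt
  · have hb : ‖deriv (fun w => A (circleMap 0 1 θ, w)) w‖ ≤ M / 1 := by
      refine norm_deriv_le_of_forall_mem_sphere_norm_le one_pos
        (hAw _).diffContOnCl fun v hv => hM _ ⟨by simp, ?_⟩
      rw [Metric.mem_closedBall]
      have h1 := Metric.mem_sphere.1 hv
      have h2 := Metric.mem_ball.1 hw
      linarith [dist_triangle v w w₀]
    simpa [hK1] using hb
  · exact ((hAw _) w).hasDerivAt.const_mul _

/-- An entire function of two variables is the sum of its double Taylor series. -/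
theorem exists_hasSum_double {A : ℂ × ℂ → ℂ} (hA : Differentiable ℂ A) :
    ∃ a : ℕ → ℕ → ℂ, ∀ u v : ℂ,
      HasSum (fun pq : ℕ × ℕ => a pq.1 pq.2 * u ^ pq.1 * v ^ pq.2) (A (u, v)) := by
  let c : ℕ → ℂ → ℂ := fun p w => (p.factorial : ℂ)⁻¹ * iteratedDeriv p (fun u => A (u, w)) 0
  have hc : ∀ p, Differentiable ℂ (c p) := fun p =>
    (differentiable_iteratedDeriv_fst hA p).const_mul _
  let a : ℕ → ℕ → ℂ := fun p q => (q.factorial : ℂ)⁻¹ * iteratedDeriv q (c p) 0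
  have taylor : ∀ {h : ℂ → ℂ}, Differentiable ℂ h → ∀ z,
      HasSum (fun n : ℕ => (n.factorial : ℂ)⁻¹ * iteratedDeriv n h 0 * z ^ n) (h z) := by
    intro h hh z
    refine (congrArg (HasSum · (h z)) (funext fun n => ?_)).mpr
      (hasSum_taylorSeries_of_entire hh 0 z)
    rw [smul_eq_mul, smul_eq_mul, sub_zero]
    ring
  have cauchy : ∀ {h : ℂ → ℂ}, Differentiable ℂ h → ∀ {R M : ℝ}, 0 < R →
      (∀ z, ‖z‖ ≤ R → ‖h z‖ ≤ M) → ∀ n : ℕ,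
      ‖(n.factorial : ℂ)⁻¹ * iteratedDeriv n h 0‖ ≤ M / R ^ n := by
    intro h hh R M hR hM n
    have := norm_iteratedDeriv_le_of_forall_mem_sphere_norm_le (c := 0) n hR hh.diffContOnCl
      fun z hz => hM z (by simpa using (mem_sphere_zero_iff_norm.1 hz).le)
    have hn : (0 : ℝ) < n.factorial := by exact_mod_cast n.factorial_pos
    rw [norm_mul, norm_inv, Complex.norm_natCast, inv_mul_le_iff₀ hn]
    simpa [mul_div_assoc] using this
  refine ⟨a, fun u v => ?_⟩
  obtain ⟨R, huR, hvR⟩ : ∃ R : ℝ, ‖u‖ < R ∧ ‖v‖ < R :=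
    ⟨max ‖u‖ ‖v‖ + 1, by linarith [le_max_left ‖u‖ ‖v‖], by linarith [le_max_right ‖u‖ ‖v‖]⟩
  have hR : 0 < R := (norm_nonneg u).trans_lt huR
  obtain ⟨M, hM⟩ : ∃ M, ∀ y ∈ Metric.closedBall (0 : ℂ × ℂ) R, ‖A y‖ ≤ M :=
    (isCompact_closedBall _ _).exists_bound_of_continuousOn hA.continuous.continuousOn
  have hcb : ∀ p w, ‖w‖ ≤ R → ‖c p w‖ ≤ M / R ^ p := by
    intro p w hw
    refine cauchy (h := fun u => A (u, w)) (by fun_prop) hR (fun z hz => hM _ ?_) p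
    simp [Prod.norm_def, hz, hw]
  have hab : ∀ p q, ‖a p q‖ ≤ M / R ^ p / R ^ q := fun p q => cauchy (hc p) hR (hcb p) q
  have hsum : Summable fun pq : ℕ × ℕ => a pq.1 pq.2 * u ^ pq.1 * v ^ pq.2 := by
    have hg : ∀ z : ℂ, ‖z‖ < R → Summable fun n : ℕ => (‖z‖ / R) ^ n := fun z hz =>
      summable_geometric_of_lt_one (by positivity) ((div_lt_one hR).2 hz)
    refine Summable.of_norm_bounded (((hg u huR).mul_of_nonneg (hg v hvR)
      (fun _ => by positivity) (fun _ => by positivity)).mul_left M) fun ⟨p, q⟩ => ?_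
    simp only [norm_mul, norm_pow]
    calc ‖a p q‖ * ‖u‖ ^ p * ‖v‖ ^ q ≤ M / R ^ p / R ^ q * ‖u‖ ^ p * ‖v‖ ^ q := by
          gcongr
          exact hab p q
      _ = _ := by rw [div_pow, div_pow]; ring
  have hinner : ∀ p, HasSum (fun q => a p q * u ^ p * v ^ q) (c p v * u ^ p) := fun p => by
    refine (congrArg (HasSum · (c p v * u ^ p)) (funext fun q => ?_)).mpr
      ((taylor (hc p) v).mul_right (u ^ p))
    simp only [a]
    ring
  have houter : HasSum (fun p => c p v * u ^ p) (A (u, v)) :=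
    taylor (h := fun u => A (u, v)) (by fun_prop) u
  exact (hsum.hasSum.prod_fiberwise hinner).unique houter ▸ hsum.hasSum

/-- Summing a summable family over a set of weights only depends on the function
`l ↦ ∑ i, x i * l ^ n i` on the unit circle. -/
theorem tsum_weight_eq_zero {ι : Type*} [Countable ι] {x : ι → ℂ} (hx : Summable x) (n : ι → ℤ)
    (h : ∀ l : ℂ, ‖l‖ = 1 → ∑' i, x i * l ^ n i = 0) (S : Set ℤ) :
    ∑' i, (n ⁻¹' S).indicator x i = 0 := by
  have hk : ∀ k : ℤ, HasSum ((n ⁻¹' {k}).indicator x) 0 := by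
    intro k
    have hint : HasSum (fun i => ∮ l in C(0, 1), x i * (l - 0) ^ (n i - k - 1))
        (∮ l in C(0, 1), (0 : ℂ)) := by
      refine intervalIntegral.hasSum_integral_of_dominated_convergence (fun i _ => ‖x i‖)
        (fun i => ?_) (fun i => ?_) (.of_forall fun _ _ => hx.norm) (by simp)
        (.of_forall fun θ _ => ?_)
      · refine Continuous.aestronglyMeasurable ?_
        simp only [deriv_circleMap, smul_eq_mul, sub_zero]
        exact ((continuous_circleMap 0 1).mul continuous_const).mul (continuous_const.mul
          ((continuous_circleMap 0 1).zpow₀ _ fun θ => .inl (circleMap_ne_center one_ne_zero)))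
      · refine .of_forall fun θ _ => ?_
        simp [norm_zpow]
      · have hl : ‖circleMap 0 1 θ‖ = 1 := by simp
        have hl0 : circleMap 0 1 θ ≠ 0 := circleMap_ne_center one_ne_zero
        have hs : Summable fun i => x i * circleMap 0 1 θ ^ n i :=
          .of_norm (by simpa [norm_zpow] using hx.norm)
        have h0 := hs.hasSum
        rw [h _ hl] at h0
        have h1 := (h0.mul_right (circleMap 0 1 θ ^ (-k - 1))).const_smul
          (deriv (circleMap 0 1) θ)
        rw [zero_mul] at h1
        refine (congrArg (HasSum · _) (funext fun i => ?_)).mpr h1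
        beta_reduce
        rw [sub_zero, mul_assoc, ← zpow_add₀ hl0, show n i - k - 1 = n i + (-k - 1) by ring]
    have hval : ∀ i, ∮ l in C(0, 1), x i * (l - 0) ^ (n i - k - 1) =
        2 * Real.pi * I * (n ⁻¹' {k}).indicator x i := by
      intro i
      rw [circleIntegral.integral_const_mul]
      by_cases hi : n i = k
      · rw [show n i - k - 1 = -1 by omega, Set.indicator_of_mem (by exact hi)]
        simp only [zpow_neg_one]
        rw [circleIntegral.integral_sub_center_inv 0 one_ne_zero, mul_comm]
      · rw [circleIntegral.integral_sub_zpow_of_ne (by omega),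
          Set.indicator_of_notMem (by exact hi)]
        simp
    have hzero : (∮ l in C(0, 1), (0 : ℂ)) = 0 := by simp [circleIntegral]
    simp only [hval, hzero] at hint
    have := hint.mul_left (2 * Real.pi * I)⁻¹
    simpa only [inv_mul_cancel_left₀ two_pi_I_ne_zero, mul_zero] using this
  have hfib := (hx.indicator (n ⁻¹' S)).hasSum.tsum_fiberwise n
  have hfib0 : ∀ k, ∑' i : n ⁻¹' {k}, (n ⁻¹' S).indicator x i = 0 := by
    intro k
    by_cases hkS : k ∈ S
    · rw [← (hk k).tsum_eq, ← tsum_subtype]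
      refine tsum_congr fun i => Set.indicator_of_mem ?_ x
      rw [Set.mem_preimage, show n i = k from i.2]
      exact hkS
    · rw [← tsum_zero (α := ℂ) (β := n ⁻¹' {k})]
      refine tsum_congr fun i => Set.indicator_of_notMem ?_ x
      rw [Set.mem_preimage, show n i = k from i.2]
      exact hkS
  simp only [hfib0] at hfib
  exact hfib.unique hasSum_zero

/-- A function holomorphic on both charts of the sphere domain is the pullback of an entire
function under `(z, w) ↦ (z / (1 - z * w), w)`. -/
theorem exists_entire_lift {f g : ℂ × ℂ → ℂ}
    (hf : DifferentiableOn ℂ f Omega0) (hg : DifferentiableOn ℂ g Omega0)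
    (hfg : ∀ u v : ℂ, u ≠ 0 → v ≠ 0 → u * v ≠ 1 → g (u, v) = f (1 / v, 1 / u)) :
    ∃ A : ℂ × ℂ → ℂ, Differentiable ℂ A ∧
      ∀ zw ∈ Omega0, f zw = A (zw.1 / (1 - zw.1 * zw.2), zw.2) := by
  classical
  have hopen : IsOpen Omega0 :=
    isOpen_ne_fun (continuous_fst.mul continuous_snd) continuous_const
  let A : ℂ × ℂ → ℂ := fun y => if 1 + y.1 * y.2 = 0 then g (1 / y.2, (1 + y.1 * y.2) / y.1)
    else f (y.1 / (1 + y.1 * y.2), y.2)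
  refine ⟨A, fun y => ?_, ?_⟩
  · by_cases hy : 1 + y.1 * y.2 = 0
    · have hy1 : y.1 ≠ 0 := by rintro h; simp [h] at hy
      have hy2 : y.2 ≠ 0 := by rintro h; simp [h] at hy
      have hmem : ∀ x : ℂ × ℂ, x.1 ≠ 0 → x.2 ≠ 0 →
          1 / x.2 * ((1 + x.1 * x.2) / x.1) ≠ 1 := by
        intro x h1 h2 h
        field_simp at h
        simp at h
      have hev : A =ᶠ[nhds y] fun x => g (1 / x.2, (1 + x.1 * x.2) / x.1) := by
        filter_upwards [continuousAt_fst.eventually_ne hy1, continuousAt_snd.eventually_ne hy2]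
          with x h1 h2
        simp only [A]
        split_ifs with h
        · rfl
        · rw [hfg _ _ (one_div_ne_zero h2) (div_ne_zero h h1) (hmem x h1 h2), one_div_div,
            one_div_one_div]
      refine DifferentiableAt.congr_of_eventuallyEq ?_ hev
      have hgd : DifferentiableAt ℂ g (1 / y.2, (1 + y.1 * y.2) / y.1) :=
        hg.differentiableAt (hopen.mem_nhds (hmem y hy1 hy2))
      refine hgd.comp y (f := fun x : ℂ × ℂ => (1 / x.2, (1 + x.1 * x.2) / x.1)) ?_
      fun_prop (disch := assumption)
    · have hev : A =ᶠ[nhds y] fun x => f (x.1 / (1 + x.1 * x.2), x.2) := by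
        have hc : ContinuousAt (fun x : ℂ × ℂ => 1 + x.1 * x.2) y := by fun_prop
        filter_upwards [hc.eventually_ne hy] with x hx
        exact if_neg hx
      refine DifferentiableAt.congr_of_eventuallyEq ?_ hev
      have hmem : (y.1 / (1 + y.1 * y.2), y.2) ∈ Omega0 := by
        intro h
        field_simp at h
        simp at h
      have hfd := hf.differentiableAt (hopen.mem_nhds hmem)
      refine hfd.comp y (f := fun x : ℂ × ℂ => (x.1 / (1 + x.1 * x.2), x.2)) ?_
      fun_prop (disch := assumption)
  · rintro ⟨z, w⟩ h
    have hd : 1 - z * w ≠ 0 := sub_ne_zero.2 (Ne.symm h)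
    have e : 1 + z / (1 - z * w) * w = 1 / (1 - z * w) := by field_simp; ring
    simp only [A, e, one_div_ne_zero hd, if_false]
    congr 2
    field_simp

/-- Continuous functions on `ℂ × ℂ` that agree after pullback under
`(z, w) ↦ (z / (1 - z * w), w)` are equal. -/
theorem eq_of_pullback_eq {P Q : ℂ × ℂ → ℂ} (hP : Continuous P) (hQ : Continuous Q)
    (h : ∀ z w : ℂ, z * w ≠ 1 → P (z / (1 - z * w), w) = Q (z / (1 - z * w), w)) : P = Q := by
  have hgen : ∀ u w : ℂ, 1 + u * w ≠ 0 → P (u, w) = Q (u, w) := by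
    intro u w hd
    have hmem : u / (1 + u * w) * w ≠ 1 := by
      intro h
      field_simp at h
      simp at h
    have e : u / (1 + u * w) / (1 - u / (1 + u * w) * w) = u := by
      rw [show 1 - u / (1 + u * w) * w = 1 / (1 + u * w) by field_simp; ring]
      field_simp
    simpa only [e] using h _ _ hmem
  funext ⟨u, w⟩
  by_cases hd : 1 + u * w = 0
  · have hline : Continuous fun t : ℂ => (u, w * t) := by fun_prop
    have := Continuous.ext_on (dense_compl_singleton (1 : ℂ)) (hP.comp hline) (hQ.comp hline)
      fun t ht => hgen u (w * t) fun h0 => ht (by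
        have huw : u * w ≠ 0 := fun h1 => by simp [h1] at hd
        have : u * w * (t - 1) = 0 := by linear_combination h0 - hd
        exact sub_eq_zero.1 ((mul_eq_zero.1 this).resolve_left huw))
    simpa using congrFun this 1
  · exact hgen u w hd

/-- If two double power series agree along the orbits of two points under the circle action
`l • (u, v) = (l * u, v / l)`, then so do their parts of nonnegative weight. -/
theorem tsum_indicator_eq_of_orbit_eq {a b : ℕ → ℕ → ℂ} {F G : ℂ × ℂ → ℂ}
    (hF : ∀ u v : ℂ, HasSum (fun pq : ℕ × ℕ => a pq.1 pq.2 * u ^ pq.1 * v ^ pq.2) (F (u, v)))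
    (hG : ∀ u v : ℂ, HasSum (fun pq : ℕ × ℕ => b pq.1 pq.2 * u ^ pq.1 * v ^ pq.2) (G (u, v)))
    {u v u' v' : ℂ} (h : ∀ l : ℂ, l ≠ 0 → F (l * u, v / l) = G (l * u', v' / l)) :
    ∑' pq, {pq : ℕ × ℕ | pq.2 ≤ pq.1}.indicator (fun pq => a pq.1 pq.2 * u ^ pq.1 * v ^ pq.2) pq =
      ∑' pq, {pq : ℕ × ℕ | pq.2 ≤ pq.1}.indicator
        (fun pq => b pq.1 pq.2 * u' ^ pq.1 * v' ^ pq.2) pq := by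
  have hx := (hF u v).summable
  have hy := (hG u' v').summable
  have hz := tsum_weight_eq_zero (hx.sub hy) (fun pq : ℕ × ℕ => (pq.1 : ℤ) - pq.2) (fun l hl => by
    have hl0 : l ≠ 0 := fun h0 => by simp [h0] at hl
    have h1 := (hF (l * u) (v / l)).sub (hG (l * u') (v' / l))
    rw [h l hl0, sub_self] at h1
    rw [← h1.tsum_eq]
    refine tsum_congr fun pq => ?_
    rw [zpow_sub₀ hl0, zpow_natCast, zpow_natCast]
    simp only [mul_pow, div_pow]
    field_simp) {k | 0 ≤ k}
  have hset : (fun pq : ℕ × ℕ => (pq.1 : ℤ) - pq.2) ⁻¹' {k | 0 ≤ k} = {pq | pq.2 ≤ pq.1} := by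
    ext pq
    simp
  rw [hset] at hz
  rw [← sub_eq_zero, ← (hx.indicator _).tsum_sub (hy.indicator _), ← hz]
  refine tsum_congr fun pq => ?_
  by_cases hpq : pq ∈ {pq : ℕ × ℕ | pq.2 ≤ pq.1} <;> simp [Set.indicator, hpq]

/-- canonical decomposition (chart version). For a pair (f,g) of
holomorphic functions on Ω₀ with g(u,v) = f(1/v, 1/u), there is a unique pair of
entire functions (F⁺, F⁻), with the Taylor coefficients of F⁺ vanishing for p < q and
those of F⁻ vanishing for p ≥ q, such that
f(z,w) = F⁺(z/(1−zw), w) + F⁻(z, w/(1−zw)) on Ω₀. -/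
theorem canonical_decomposition
    (f g : ℂ × ℂ → ℂ)
    (hf : DifferentiableOn ℂ f Omega0) (hg : DifferentiableOn ℂ g Omega0)
    (hfg : ∀ u v : ℂ, u ≠ 0 → v ≠ 0 → u * v ≠ 1 → g (u, v) = f (1 / v, 1 / u)) :
    ∃! FF : (ℂ × ℂ → ℂ) × (ℂ × ℂ → ℂ),
      Differentiable ℂ FF.1 ∧ Differentiable ℂ FF.2 ∧
      (∃ a : ℕ → ℕ → ℂ, (∀ p q : ℕ, p < q → a p q = 0) ∧
        ∀ u v : ℂ, HasSum (fun pq : ℕ × ℕ => a pq.1 pq.2 * u ^ pq.1 * v ^ pq.2)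
          (FF.1 (u, v))) ∧
      (∃ b : ℕ → ℕ → ℂ, (∀ p q : ℕ, q ≤ p → b p q = 0) ∧
        ∀ u v : ℂ, HasSum (fun pq : ℕ × ℕ => b pq.1 pq.2 * u ^ pq.1 * v ^ pq.2)
          (FF.2 (u, v))) ∧
      (∀ zw ∈ Omega0,
        f zw = FF.1 (zw.1 / (1 - zw.1 * zw.2), zw.2)
             + FF.2 (zw.1, zw.2 / (1 - zw.1 * zw.2))) := by
  have hscale : ∀ {z w l : ℂ}, l ≠ 0 → l * z * (w / l) = z * w := fun hl => by field_simp
  refine existsUnique_of_exists_of_unique ?_ ?_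
  · obtain ⟨A, hA, hfA⟩ := exists_entire_lift hf hg hfg
    obtain ⟨B, hB, hfB⟩ : ∃ B : ℂ × ℂ → ℂ, Differentiable ℂ B ∧
        ∀ zw ∈ Omega0, f zw = B (zw.1, zw.2 / (1 - zw.1 * zw.2)) := by
      have hswap : Set.MapsTo Prod.swap Omega0 Omega0 := fun x hx h => hx (by
        simpa [mul_comm] using h)
      have hsd : Differentiable ℂ (Prod.swap : ℂ × ℂ → ℂ × ℂ) :=
        differentiable_snd.prodMk differentiable_fst
      obtain ⟨B, hB, hfB⟩ := exists_entire_lift (f := f ∘ Prod.swap) (g := g ∘ Prod.swap)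
        (hf.comp hsd.differentiableOn hswap) (hg.comp hsd.differentiableOn hswap)
        fun u v hu hv huv => hfg v u hv hu (by rwa [mul_comm])
      refine ⟨B ∘ Prod.swap, hB.comp hsd, fun zw h => ?_⟩
      have := hfB zw.swap (hswap h)
      simpa [mul_comm] using this
    obtain ⟨a, ha⟩ := exists_hasSum_double hA
    obtain ⟨b, hb⟩ := exists_hasSum_double hB
    let S : Set (ℕ × ℕ) := {pq | pq.2 ≤ pq.1}
    let P : ℂ × ℂ → ℂ := fun x =>
      ∑' pq, S.indicator (fun pq => a pq.1 pq.2 * x.1 ^ pq.1 * x.2 ^ pq.2) pq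
    let N : ℂ × ℂ → ℂ := fun x =>
      B x - ∑' pq, S.indicator (fun pq => b pq.1 pq.2 * x.1 ^ pq.1 * x.2 ^ pq.2) pq
    obtain ⟨c, hc, hP⟩ : ∃ c : ℕ → ℕ → ℂ, (∀ p q : ℕ, p < q → c p q = 0) ∧ ∀ u v : ℂ,
        HasSum (fun pq : ℕ × ℕ => c pq.1 pq.2 * u ^ pq.1 * v ^ pq.2) (P (u, v)) := by
      refine ⟨fun p q => if q ≤ p then a p q else 0, fun p q hpq => if_neg hpq.not_ge,
        fun u v => ?_⟩
      refine (congrArg (HasSum · _) (funext fun pq => ?_)).mpr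
        ((ha u v).summable.indicator S).hasSum
      by_cases h : pq.2 ≤ pq.1 <;> simp [S, Set.indicator, h]
    obtain ⟨d, hd, hN⟩ : ∃ d : ℕ → ℕ → ℂ, (∀ p q : ℕ, q ≤ p → d p q = 0) ∧ ∀ u v : ℂ,
        HasSum (fun pq : ℕ × ℕ => d pq.1 pq.2 * u ^ pq.1 * v ^ pq.2) (N (u, v)) := by
      refine ⟨fun p q => if q ≤ p then 0 else b p q, fun p q hpq => if_pos hpq,
        fun u v => ?_⟩
      refine (congrArg (HasSum · _) (funext fun pq => ?_)).mpr
        ((hb u v).sub ((hb u v).summable.indicator S).hasSum)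
      by_cases h : pq.2 ≤ pq.1 <;> simp [S, Set.indicator, h]
    refine ⟨(P, N), differentiable_of_hasSum_double hP, differentiable_of_hasSum_double hN,
      ⟨c, hc, hP⟩, ⟨d, hd, hN⟩, ?_⟩
    rintro ⟨z, w⟩ hzw
    have key := tsum_indicator_eq_of_orbit_eq ha hb (u := z / (1 - z * w)) (v := w) (u' := z)
      (v' := w / (1 - z * w)) fun l hl => by
        have hmem : (l * z, w / l) ∈ Omega0 := by
          intro h
          exact hzw ((hscale hl).symm.trans h)
        have h1 := hfA _ hmem
        rw [hfB _ hmem] at h1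
        simp only [hscale hl] at h1
        rw [← mul_div_assoc, ← h1, div_right_comm]
    simp only [P, N, S, key, hfB _ hzw]
    ring
  · rintro ⟨P, N⟩ ⟨P', N'⟩ ⟨hP, hN, ⟨a, ha, haP⟩, ⟨b, hb, hbN⟩, hf1⟩
      ⟨hP', hN', ⟨a', ha', haP'⟩, ⟨b', hb', hbN'⟩, hf2⟩
    have hPd : ∀ u v : ℂ, HasSum (fun pq : ℕ × ℕ => (a - a') pq.1 pq.2 * u ^ pq.1 * v ^ pq.2)
        ((P - P') (u, v)) := fun u v => by
      refine (congrArg (HasSum · _) (funext fun pq => ?_)).mpr ((haP u v).sub (haP' u v))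
      simp only [Pi.sub_apply]
      ring
    have hNd : ∀ u v : ℂ, HasSum (fun pq : ℕ × ℕ => (b' - b) pq.1 pq.2 * u ^ pq.1 * v ^ pq.2)
        ((N' - N) (u, v)) := fun u v => by
      refine (congrArg (HasSum · _) (funext fun pq => ?_)).mpr ((hbN' u v).sub (hbN u v))
      simp only [Pi.sub_apply]
      ring
    have hPeq : ∀ z w : ℂ, z * w ≠ 1 → P (z / (1 - z * w), w) = P' (z / (1 - z * w), w) := by
      intro z w hzw
      have key := tsum_indicator_eq_of_orbit_eq hPd hNd (u := z / (1 - z * w)) (v := w)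
        (u' := z) (v' := w / (1 - z * w)) fun l hl => by
          have hmem : (l * z, w / l) ∈ Omega0 := by
            intro h
            exact hzw ((hscale hl).symm.trans h)
          have h1 := hf1 _ hmem
          rw [hf2 _ hmem] at h1
          simp only [hscale hl] at h1
          rw [← mul_div_assoc, div_right_comm w]
          simp only [Pi.sub_apply]
          linear_combination -h1
      have hl : ∀ pq : ℕ × ℕ, {pq : ℕ × ℕ | pq.2 ≤ pq.1}.indicator
          (fun pq => (a - a') pq.1 pq.2 * (z / (1 - z * w)) ^ pq.1 * w ^ pq.2) pq =
          (a - a') pq.1 pq.2 * (z / (1 - z * w)) ^ pq.1 * w ^ pq.2 := by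
        intro pq
        by_cases h : pq.2 ≤ pq.1
        · simp [h]
        · simp [h, ha _ _ (not_le.1 h), ha' _ _ (not_le.1 h)]
      have hr : ∀ pq : ℕ × ℕ, {pq : ℕ × ℕ | pq.2 ≤ pq.1}.indicator
          (fun pq => (b' - b) pq.1 pq.2 * z ^ pq.1 * (w / (1 - z * w)) ^ pq.2) pq = 0 := by
        intro pq
        by_cases h : pq.2 ≤ pq.1
        · simp [h, hb _ _ h, hb' _ _ h]
        · simp [h]
      rw [tsum_congr hl, tsum_congr hr, tsum_zero, (hPd _ _).tsum_eq] at key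
      exact sub_eq_zero.1 key
    have hNeq : ∀ z w : ℂ, z * w ≠ 1 → N (w, z / (1 - z * w)) = N' (w, z / (1 - z * w)) := by
      intro z w hzw
      have hwz : (w, z) ∈ Omega0 := fun h => hzw (by rw [mul_comm]; exact h)
      have h1 := hf1 _ hwz
      rw [hf2 _ hwz] at h1
      simp only [hPeq w z hwz] at h1
      rw [mul_comm z w]
      exact (add_left_cancel h1).symm
    have e1 : P = P' := eq_of_pullback_eq hP.continuous hP'.continuous hPeq
    have e2 : N ∘ Prod.swap = N' ∘ Prod.swap :=
      eq_of_pullback_eq (hN.continuous.comp continuous_swap) (hN'.continuous.comp continuous_swap)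
        hNeq
    rw [e1, Prod.swap_surjective.injective_comp_right e2]
end

section
/- Let O ⊆ G₀ = {(z,w) ∈ ℂ × ℂ : z ≠ w} be a nonempty open connected set and let T = (T₁, T₂) : O → G₀ be holomorphic. Assume that for every holomorphic function F : G₀ → ℂ and every (z,w) ∈ O, (z − w)² · ∂_z∂_w(F ∘ T)(z,w) = (T₁(z,w) − T₂(z,w))² · (∂₁∂₂F)(T(z,w)). Then there exist a,b,c,d ∈ ℂ with ad − bc ≠ 0 such that either T(z,w) = ((az+b)/(cz+d), (aw+b)/(cw+d)) for all (z,w) ∈ O (with cz+d ≠ 0 and cw+d ≠ 0 on O), or T(z,w) = ((aw+b)/(cw+d), (az+b)/(cz+d)) for all (z,w) ∈ O. -/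
open Complex

/-- The affine chart of the second configuration space of the Riemann sphere. -/
def G0 : Set (ℂ × ℂ) := {p | p.1 ≠ p.2}

/-- The mixed second complex partial derivative ∂_z∂_w F of F : ℂ × ℂ → ℂ. -/
noncomputable def mixedDeriv (F : ℂ × ℂ → ℂ) (p : ℂ × ℂ) : ℂ :=
  deriv (fun z => deriv (fun w => F (z, w)) p.2) p.1

section SeveralVariables

open Metric Set Filter Topology

variable {E : Type*} [NormedAddCommGroup E] [NormedSpace ℂ E] {f : E → ℂ} {U : Set E}

theorem DifferentiableAt.hasDerivAt_comp_add_smul {x : E} (e : E) {t : ℂ}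
    (hf : DifferentiableAt ℂ f (x + t • e)) :
    HasDerivAt (fun s : ℂ => f (x + s • e)) (fderiv ℂ f (x + t • e) e) t := by
  have h : HasDerivAt (fun s : ℂ => x + s • e) e t := by
    simpa using ((hasDerivAt_id t).smul_const e).const_add x
  exact hf.hasFDerivAt.comp_hasDerivAt t h

/-- Cauchy's estimate for the Fréchet derivative of a bounded holomorphic function. -/
theorem norm_fderiv_le_of_forall_mem_ball {x : E} {ρ M : ℝ} (hρ : 0 < ρ)
    (hf : DifferentiableOn ℂ f (ball x ρ)) (hM : ∀ y ∈ ball x ρ, ‖f y‖ ≤ M) :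
    ‖fderiv ℂ f x‖ ≤ 2 * M / ρ := by
  have hM0 : 0 ≤ M := (norm_nonneg _).trans (hM x (mem_ball_self hρ))
  refine ContinuousLinearMap.opNorm_le_bound _ (by positivity) fun v => ?_
  rcases eq_or_ne v 0 with rfl | hv
  · simp
  have hv' : 0 < ‖v‖ := norm_pos_iff.2 hv
  set R : ℝ := ρ / (2 * ‖v‖) with hR
  have hR0 : 0 < R := by positivity
  have hmem : ∀ t ∈ closedBall (0 : ℂ) R, x + t • v ∈ ball x ρ := by
    intro t ht
    rw [mem_closedBall_zero_iff] at ht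
    rw [mem_ball_iff_norm, add_sub_cancel_left, norm_smul]
    calc ‖t‖ * ‖v‖ ≤ R * ‖v‖ := by gcongr
      _ = ρ / 2 := by rw [hR]; field_simp
      _ < ρ := by linarith
  have hd : ∀ t ∈ closedBall (0 : ℂ) R,
      HasDerivAt (fun s : ℂ => f (x + s • v)) (fderiv ℂ f (x + t • v) v) t := fun t ht =>
    (hf.differentiableAt (isOpen_ball.mem_nhds (hmem t ht))).hasDerivAt_comp_add_smul v
  have hdc : DiffContOnCl ℂ (fun s : ℂ => f (x + s • v)) (ball 0 R) :=
    DifferentiableOn.diffContOnCl_ball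
      (fun t ht => (hd t ht).differentiableAt.differentiableWithinAt) Subset.rfl
  have h := norm_deriv_le_of_forall_mem_sphere_norm_le hR0 hdc
    fun t ht => hM _ (hmem t (sphere_subset_closedBall ht))
  rw [(hd 0 (mem_closedBall_self hR0.le)).deriv] at h
  simp only [zero_smul, add_zero] at h
  calc ‖fderiv ℂ f x v‖ ≤ M / R := h
    _ = 2 * M / ρ * ‖v‖ := by rw [hR]; field_simp

/-- Directional derivatives of holomorphic functions of several variables are holomorphic. -/
theorem differentiableOn_fderiv_apply_const [FiniteDimensional ℂ E]
    (hf : DifferentiableOn ℂ f U) (hU : IsOpen U) (e : E) :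
    DifferentiableOn ℂ (fun p => fderiv ℂ f p e) U := by
  intro p₀ hp₀
  have hbdd : ∀ᶠ y in 𝓝 p₀, ‖f y‖ < ‖f p₀‖ + 1 :=
    (hf.differentiableAt (hU.mem_nhds hp₀)).continuousAt.norm.eventually_lt_const
      (lt_add_one _)
  obtain ⟨δ, hδ, hball⟩ := Metric.mem_nhds_iff.1 (inter_mem (hU.mem_nhds hp₀) hbdd)
  set M := ‖f p₀‖ + 1
  set ρ := δ / 3 with hρδ
  have hρ : 0 < ρ := by positivity
  set r : ℝ := ρ / (‖e‖ + 1) with hr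
  have hr0 : 0 < r := by positivity
  have hmem : ∀ x ∈ ball p₀ ρ, ∀ t ∈ closedBall (0 : ℂ) r, x + t • e ∈ ball p₀ (2 * ρ) := by
    intro x hx t ht
    rw [mem_closedBall_zero_iff] at ht
    rw [mem_ball_iff_norm] at hx ⊢
    have h1 : ‖t • e‖ ≤ ρ := by
      rw [norm_smul]
      calc ‖t‖ * ‖e‖ ≤ r * (‖e‖ + 1) := by gcongr; linarith
        _ = ρ := by rw [hr]; field_simp
    calc ‖x + t • e - p₀‖ = ‖(x - p₀) + t • e‖ := by congr 1; abel
      _ ≤ ‖x - p₀‖ + ‖t • e‖ := norm_add_le _ _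
      _ < 2 * ρ := by linarith
  have hsub : ball p₀ (2 * ρ) ⊆ U := fun y hy =>
    (hball (ball_subset_ball (by linarith) hy)).1
  have hdiff : ∀ y ∈ ball p₀ (2 * ρ), DifferentiableAt ℂ f y := fun y hy =>
    hf.differentiableAt (hU.mem_nhds (hsub hy))
  have hfd : ∀ y ∈ ball p₀ (2 * ρ), ‖fderiv ℂ f y‖ ≤ 2 * M / ρ := by
    intro y hy
    have hsub' : ball y ρ ⊆ ball p₀ δ := by
      refine ball_subset_ball' ?_
      rw [mem_ball] at hy
      linarith
    exact norm_fderiv_le_of_forall_mem_ball hρ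
      (hf.mono fun z hz => (hball (hsub' hz)).1) fun z hz => (hball (hsub' hz)).2.le
  have hcirc : ∀ θ : ℝ, circleMap (0 : ℂ) r θ ∈ closedBall (0 : ℂ) r :=
    circleMap_mem_closedBall 0 hr0.le
  have hk : Continuous fun θ : ℝ => deriv (circleMap 0 r) θ * ((circleMap 0 r θ - 0) ^ 2)⁻¹ := by
    simp only [deriv_circleMap, sub_zero]
    exact ((continuous_circleMap 0 r).mul continuous_const).mul
      (((continuous_circleMap 0 r).pow 2).inv₀
        fun θ => pow_ne_zero 2 (circleMap_ne_center hr0.ne'))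
  have hcont : ∀ x ∈ ball p₀ ρ, Continuous fun θ : ℝ =>
      (deriv (circleMap 0 r) θ * ((circleMap 0 r θ - 0) ^ 2)⁻¹) • f (x + circleMap 0 r θ • e) := by
    intro x hx
    refine hk.smul (ContinuousOn.comp_continuous (s := U) hf.continuousOn ?_
      fun θ => hsub (hmem x hx _ (hcirc θ)))
    exact continuous_const.add ((continuous_circleMap 0 r).smul continuous_const)
  have hint : HasFDerivAt (fun x : E => ∫ θ in (0 : ℝ)..2 * Real.pi,
      (deriv (circleMap 0 r) θ * ((circleMap 0 r θ - 0) ^ 2)⁻¹) • f (x + circleMap 0 r θ • e))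
      (∫ θ in (0 : ℝ)..2 * Real.pi, (deriv (circleMap 0 r) θ *
        ((circleMap 0 r θ - 0) ^ 2)⁻¹) • fderiv ℂ f (p₀ + circleMap 0 r θ • e)) p₀ := by
    borelize E
    have : ProperSpace E := FiniteDimensional.proper ℂ E
    refine intervalIntegral.hasFDerivAt_integral_of_dominated_of_fderiv_le
      (F' := fun x θ => (deriv (circleMap 0 r) θ *
        ((circleMap 0 r θ - 0) ^ 2)⁻¹) • fderiv ℂ f (x + circleMap 0 r θ • e))
      (bound := fun _ => 1 / r * (2 * M / ρ))
      (ball_mem_nhds p₀ hρ) ?_ ?_ ?_ ?_ ?_ ?_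
    · filter_upwards [ball_mem_nhds p₀ hρ] with x hx using (hcont x hx).aestronglyMeasurable
    · exact (hcont p₀ (mem_ball_self hρ)).intervalIntegrable _ _
    · refine hk.aestronglyMeasurable.smul (Measurable.aestronglyMeasurable ?_)
      exact (measurable_fderiv ℂ f).comp
        (continuous_const.add ((continuous_circleMap 0 r).smul continuous_const)).measurable
    · refine Eventually.of_forall fun θ _ x hx => ?_
      rw [norm_smul]
      gcongr
      · refine le_of_eq ?_
        simp only [deriv_circleMap, sub_zero, norm_mul, norm_inv, norm_pow, norm_circleMap_zero,
          norm_I, abs_of_pos hr0]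
        field_simp
      · exact hfd _ (hmem x hx _ (hcirc θ))
    · exact intervalIntegrable_const
    · refine Eventually.of_forall fun θ _ x hx => ?_
      have h := (hdiff _ (hmem x hx _ (hcirc θ))).hasFDerivAt
      exact ((hasFDerivAt_comp_add_right (circleMap 0 r θ • e)).2 h).fun_const_smul _
  have heq : (fun p => fderiv ℂ f p e) =ᶠ[𝓝 p₀] fun x => (2 * Real.pi * I : ℂ)⁻¹ •
      ∫ θ in (0 : ℝ)..2 * Real.pi,
        (deriv (circleMap 0 r) θ * ((circleMap 0 r θ - 0) ^ 2)⁻¹) •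
          f (x + circleMap 0 r θ • e) := by
    filter_upwards [ball_mem_nhds p₀ hρ] with x hx
    have hlin : Continuous fun t : ℂ => x + t • e := by fun_prop
    have hd : DifferentiableOn ℂ (fun t : ℂ => f (x + t • e))
        ((fun t : ℂ => x + t • e) ⁻¹' ball p₀ (2 * ρ)) := fun t ht =>
      ((hdiff _ ht).hasDerivAt_comp_add_smul e).differentiableAt.differentiableWithinAt
    have h := cderiv_eq_deriv (isOpen_ball.preimage hlin) hd hr0 (hmem x hx)
    have h0 := hdiff _ (hmem x hx 0 (mem_closedBall_self hr0.le))
    rw [(h0.hasDerivAt_comp_add_smul e).deriv] at h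
    simp only [zero_smul, add_zero] at h
    rw [← h, cderiv, circleIntegral]
    simp only [smul_smul]
  exact ((hint.fun_const_smul _).congr_of_eventuallyEq heq).differentiableAt.differentiableWithinAt

/-- The identity principle for holomorphic functions of several variables. -/
theorem eqOn_zero_of_differentiableOn_of_preconnected
    (hf : DifferentiableOn ℂ f U) (hU : IsOpen U) (hUc : IsPreconnected U) {p₀ : E}
    (hp₀ : p₀ ∈ U) (h0 : f =ᶠ[𝓝 p₀] 0) : EqOn f 0 U := by
  have key : U ⊆ interior {p | f p = 0} := by
    refine hUc.subset_of_closure_inter_subset isOpen_interior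
      ⟨p₀, hp₀, mem_interior_iff_mem_nhds.2 h0⟩ ?_
    rintro p ⟨hpc, hpU⟩
    obtain ⟨r, hr, hball⟩ := Metric.mem_nhds_iff.1 (hU.mem_nhds hpU)
    obtain ⟨q, hqi, hq⟩ := Metric.mem_closure_iff.1 hpc r hr
    rw [← mem_ball'] at hq
    refine mem_interior_iff_mem_nhds.2 (mem_of_superset (ball_mem_nhds p hr) fun x hx => ?_)
    have hlin : Continuous fun t : ℂ => q + t • (x - q) := by fun_prop
    set V : Set ℂ := (fun t : ℂ => q + t • (x - q)) ⁻¹' ball p r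
    have hVo : IsOpen V := isOpen_ball.preimage hlin
    have hVc : IsPreconnected V := by
      have hcv : Convex ℝ V := by
        intro s hs t ht a b ha hb hab
        have h := (convex_ball p r) hs ht ha hb hab
        simp only [V, mem_preimage]
        convert h using 1
        obtain rfl : b = 1 - a := by linarith
        simp only [add_smul, smul_assoc, smul_add, sub_smul, one_smul]
        abel
      exact hcv.isPreconnected
    have hd : DifferentiableOn ℂ (fun t : ℂ => f (q + t • (x - q))) V := fun t ht =>
      ((hf.differentiableAt (hU.mem_nhds (hball ht))).hasDerivAt_comp_add_smul
        _).differentiableAt.differentiableWithinAt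
    have hz : (fun t : ℂ => f (q + t • (x - q))) =ᶠ[𝓝 0] 0 := by
      have : ∀ᶠ y in 𝓝 (q + (0 : ℂ) • (x - q)), f y = 0 := by
        rw [zero_smul, add_zero]
        exact mem_interior_iff_mem_nhds.1 hqi
      exact hlin.continuousAt.eventually this
    have h := (hd.analyticOnNhd hVo).eqOn_zero_of_preconnected_of_eventuallyEq_zero hVc
      (z₀ := 0) (by simpa [V] using hq) hz
    have h1 := h (x := 1) (by simpa [V] using hx)
    simpa using h1
  intro p hp
  exact interior_subset (s := {p | f p = 0}) (key hp)

end SeveralVariables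

section PartialDerivatives

open Metric Set Filter Topology

variable {f g : ℂ × ℂ → ℂ} {U : Set (ℂ × ℂ)} {p : ℂ × ℂ}

theorem DifferentiableAt.hasDerivAt_fst (hf : DifferentiableAt ℂ f p) :
    HasDerivAt (fun z => f (z, p.2)) (fderiv ℂ f p (1, 0)) p.1 :=
  HasFDerivAt.comp_hasDerivAt (f := fun z : ℂ => (z, p.2)) p.1 hf.hasFDerivAt
    ((hasDerivAt_id p.1).prodMk (hasDerivAt_const p.1 p.2))

theorem DifferentiableAt.hasDerivAt_snd (hf : DifferentiableAt ℂ f p) :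
    HasDerivAt (fun w => f (p.1, w)) (fderiv ℂ f p (0, 1)) p.2 :=
  HasFDerivAt.comp_hasDerivAt (f := fun w : ℂ => (p.1, w)) p.2 hf.hasFDerivAt
    ((hasDerivAt_const p.2 p.1).prodMk (hasDerivAt_id p.2))

theorem mixedDeriv_eq_fderiv_fderiv (hf : DifferentiableOn ℂ f U) (hU : IsOpen U) (hp : p ∈ U) :
    mixedDeriv f p = fderiv ℂ (fun q => fderiv ℂ f q (0, 1)) p (1, 0) := by
  have hev : ∀ᶠ z in 𝓝 p.1, (z, p.2) ∈ U :=
    (Continuous.prodMk_left p.2).continuousAt.eventually (hU.mem_nhds hp)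
  have h : (fun z => deriv (fun w => f (z, w)) p.2) =ᶠ[𝓝 p.1]
      fun z => fderiv ℂ f (z, p.2) (0, 1) := by
    filter_upwards [hev] with z hz
    exact (hf.differentiableAt (hU.mem_nhds hz)).hasDerivAt_snd.deriv
  rw [mixedDeriv, h.deriv_eq]
  exact ((differentiableOn_fderiv_apply_const hf hU (0, 1)).differentiableAt
    (hU.mem_nhds hp)).hasDerivAt_fst.deriv

/-- The Leibniz rule for the mixed second derivative. -/
theorem mixedDeriv_mul (hf : DifferentiableOn ℂ f U) (hg : DifferentiableOn ℂ g U)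
    (hU : IsOpen U) (hp : p ∈ U) :
    mixedDeriv (fun q => f q * g q) p =
      mixedDeriv f p * g p + fderiv ℂ f p (0, 1) * fderiv ℂ g p (1, 0) +
        fderiv ℂ f p (1, 0) * fderiv ℂ g p (0, 1) + f p * mixedDeriv g p := by
  have h : (fun q => fderiv ℂ (fun q => f q * g q) q (0, 1)) =ᶠ[𝓝 p]
      fun q => f q * fderiv ℂ g q (0, 1) + g q * fderiv ℂ f q (0, 1) := by
    filter_upwards [hU.mem_nhds hp] with q hq
    rw [fderiv_fun_mul (hf.differentiableAt (hU.mem_nhds hq))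
      (hg.differentiableAt (hU.mem_nhds hq))]
    simp
  have hfp := hf.differentiableAt (hU.mem_nhds hp)
  have hgp := hg.differentiableAt (hU.mem_nhds hp)
  have hf' := (differentiableOn_fderiv_apply_const hf hU (0, 1)).differentiableAt
    (hU.mem_nhds hp)
  have hg' := (differentiableOn_fderiv_apply_const hg hU (0, 1)).differentiableAt
    (hU.mem_nhds hp)
  rw [mixedDeriv_eq_fderiv_fderiv (hf.fun_mul hg) hU hp, mixedDeriv_eq_fderiv_fderiv hf hU hp,
    mixedDeriv_eq_fderiv_fderiv hg hU hp, h.fderiv_eq,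
    fderiv_fun_add (hfp.fun_mul hg') (hgp.fun_mul hf'), fderiv_fun_mul hfp hg',
    fderiv_fun_mul hgp hf']
  simp only [add_apply, smul_apply, smul_eq_mul]
  ring

end PartialDerivatives

section Moebius

open Metric Set Filter Topology

/-- If `(f z - g w) ^ 2 = (z - w) ^ 2 * A z * B w` with nonvanishing sides on a product of connected
sets, then `f` and `g` are restrictions of the same Möbius transformation. -/
theorem exists_moebius_of_sq_sub_eq {D₁ D₂ : Set ℂ} (hD₁ : IsPreconnected D₁)
    (hD₂ : IsPreconnected D₂) (hn₁ : D₁.Nontrivial) (hn₂ : D₂.Nontrivial)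
    {f g A B : ℂ → ℂ} (hf : ContinuousOn f D₁) (hg : ContinuousOn g D₂)
    (hne : ∀ z ∈ D₁, ∀ w ∈ D₂, z ≠ w) (hfg : ∀ z ∈ D₁, ∀ w ∈ D₂, f z ≠ g w)
    (h : ∀ z ∈ D₁, ∀ w ∈ D₂, (f z - g w) ^ 2 = (z - w) ^ 2 * (A z * B w)) :
    ∃ a b c d : ℂ, a * d - b * c ≠ 0 ∧ (∀ z ∈ D₁, (c * z + d) * f z = a * z + b) ∧
      ∀ w ∈ D₂, (c * w + d) * g w = a * w + b := by
  obtain ⟨z₀, hz₀, z₁, hz₁, hz⟩ := hn₁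
  obtain ⟨w₀, hw₀, w₁, hw₁, hw⟩ := hn₂
  set H : ℂ → ℂ → ℂ := fun z w => (f z - g w) / (z - w) with hH
  have hHne : ∀ z ∈ D₁, ∀ w ∈ D₂, H z w ≠ 0 := fun z hz w hw =>
    div_ne_zero (sub_ne_zero.2 (hfg z hz w hw)) (sub_ne_zero.2 (hne z hz w hw))
  have hHsq : ∀ z ∈ D₁, ∀ w ∈ D₂, H z w ^ 2 = A z * B w := by
    intro z hz w hw
    rw [hH, div_pow, h z hz w hw]
    exact mul_div_cancel_left₀ _ (pow_ne_zero 2 (sub_ne_zero.2 (hne z hz w hw)))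
  have hHc : ContinuousOn (fun p : ℂ × ℂ => H p.1 p.2) (D₁ ×ˢ D₂) := by
    refine ContinuousOn.div ?_ (by fun_prop)
      fun p hp => sub_ne_zero.2 (hne p.1 hp.1 p.2 hp.2)
    exact (hf.comp continuousOn_fst fun p hp => hp.1).sub
      (hg.comp continuousOn_snd fun p hp => hp.2)
  have hrank : EqOn (fun p : ℂ × ℂ => H p.1 p.2 * H z₀ w₀)
      (fun p => H p.1 w₀ * H z₀ p.2) (D₁ ×ˢ D₂) := by
    refine (hD₁.prod hD₂).eq_of_sq_eq (y := (z₀, w₀)) (hHc.mul continuousOn_const)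
      (ContinuousOn.mul ?_ ?_) ?_ ?_ ⟨hz₀, hw₀⟩ rfl
    · exact hHc.comp (f := fun p : ℂ × ℂ => (p.1, w₀)) (by fun_prop) fun p hp => ⟨hp.1, hw₀⟩
    · exact hHc.comp (f := fun p : ℂ × ℂ => (z₀, p.2)) (by fun_prop) fun p hp => ⟨hz₀, hp.2⟩
    · intro p hp
      simp only [Pi.pow_apply, mul_pow]
      rw [hHsq _ hp.1 _ hp.2, hHsq _ hz₀ _ hw₀, hHsq _ hp.1 _ hw₀, hHsq _ hz₀ _ hp.2]
      ring
    · exact fun {p} hp => mul_ne_zero (hHne _ hp.1 _ hw₀) (hHne _ hz₀ _ hp.2)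
  set α : ℂ → ℂ := fun z => H z w₀
  set β : ℂ → ℂ := fun w => H z₀ w / H z₀ w₀ with hβ
  have hαne : ∀ z ∈ D₁, α z ≠ 0 := fun z hz => hHne z hz w₀ hw₀
  have hβne : ∀ w ∈ D₂, β w ≠ 0 := fun w hw => div_ne_zero (hHne z₀ hz₀ w hw) (hHne z₀ hz₀ w₀ hw₀)
  have hβ₀ : β w₀ = 1 := div_self (hHne z₀ hz₀ w₀ hw₀)
  have hfac : ∀ z ∈ D₁, ∀ w ∈ D₂, f z - g w = (z - w) * (α z * β w) := by
    intro z hz w hw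
    have h1 : H z w * H z₀ w₀ = α z * H z₀ w := hrank (x := (z, w)) ⟨hz, hw⟩
    have h2 : H z w = α z * β w := by
      rw [hβ, ← mul_div_assoc, eq_div_iff (hHne z₀ hz₀ w₀ hw₀), h1]
    rw [← h2, hH, mul_div_cancel₀ _ (sub_ne_zero.2 (hne z hz w hw))]
  clear_value α β
  have hlin : ∀ z ∈ D₁, α z * ((1 - β w₁) * z + (β w₁ * w₁ - w₀)) = g w₁ - g w₀ := by
    intro z hz
    have e0 := hfac z hz w₀ hw₀
    have e1 := hfac z hz w₁ hw₁
    rw [hβ₀] at e0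
    linear_combination e1 - e0
  have hk : g w₁ - g w₀ ≠ 0 := by
    intro hk
    have e : ∀ z ∈ D₁, (1 - β w₁) * z + (β w₁ * w₁ - w₀) = 0 := fun z hz =>
      (mul_eq_zero.1 ((hlin z hz).trans hk)).resolve_left (hαne z hz)
    have hβ₁ : 1 - β w₁ = 0 := by
      refine (mul_eq_zero.1 (?_ : (1 - β w₁) * (z₀ - z₁) = 0)).resolve_right (sub_ne_zero.2 hz)
      linear_combination e z₀ hz₀ - e z₁ hz₁
    exact hw (by linear_combination -(e z₀ hz₀) + (z₀ - w₁) * hβ₁)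
  set k := g w₁ - g w₀
  set c := 1 - β w₁ with hc
  set d := β w₁ * w₁ - w₀ with hd
  clear_value k c d
  have hfm : ∀ z ∈ D₁, (c * z + d) * f z = (g w₀ * c + k) * z + (g w₀ * d - k * w₀) := by
    intro z hz
    have e0 := hfac z hz w₀ hw₀
    rw [hβ₀] at e0
    linear_combination (c * z + d) * e0 + (z - w₀) * hlin z hz
  refine ⟨g w₀ * c + k, g w₀ * d - k * w₀, c, d, ?_, hfm, fun w hw => ?_⟩
  · have : (g w₀ * c + k) * d - (g w₀ * d - k * w₀) * c = k * (β w₁ * (w₁ - w₀)) := by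
      rw [hc, hd]; ring
    rw [this]
    exact mul_ne_zero hk (mul_ne_zero (hβne w₁ hw₁) (sub_ne_zero.2 hw.symm))
  · have e : ∀ z ∈ D₁, (g w₀ * c + k) * z + (g w₀ * d - k * w₀) - (c * z + d) * g w
        = (z - w) * (k * β w) := by
      intro z hz
      linear_combination (c * z + d) * hfac z hz w hw - hfm z hz + (z - w) * β w * hlin z hz
    have hs : g w₀ * c + k - c * g w - k * β w = 0 := by
      refine (mul_eq_zero.1 (?_ : _ * (z₀ - z₁) = 0)).resolve_right (sub_ne_zero.2 hz)
      linear_combination e z₀ hz₀ - e z₁ hz₁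
    linear_combination -(e z₀ hz₀) + (z₀ - w) * hs

/-- A map whose components depend on one variable each and which is compatible with the Laplacian
is a diagonal Möbius map. -/
theorem exists_moebius_of_separated {O : Set (ℂ × ℂ)} (hO : IsOpen O) (hOc : IsConnected O)
    (hOG : O ⊆ G0) {u v : ℂ × ℂ → ℂ} (hu : DifferentiableOn ℂ u O) (hv : DifferentiableOn ℂ v O)
    (huv : ∀ p ∈ O, u p ≠ v p) (hu₂ : ∀ p ∈ O, fderiv ℂ u p (0, 1) = 0)
    (hv₁ : ∀ p ∈ O, fderiv ℂ v p (1, 0) = 0)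
    (h : ∀ p ∈ O, (p.1 - p.2) ^ 2 * (fderiv ℂ u p (1, 0) * fderiv ℂ v p (0, 1))
      = (u p - v p) ^ 2) :
    ∃ a b c d : ℂ, a * d - b * c ≠ 0 ∧ ∀ p ∈ O, (c * p.1 + d ≠ 0 ∧ c * p.2 + d ≠ 0) ∧
      u p = (a * p.1 + b) / (c * p.1 + d) ∧ v p = (a * p.2 + b) / (c * p.2 + d) := by
  obtain ⟨p₀, hp₀⟩ := hOc.nonempty
  obtain ⟨r, hr, hball⟩ := Metric.mem_nhds_iff.1 (hO.mem_nhds hp₀)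
  have hsub : ball p₀.1 r ×ˢ ball p₀.2 r ⊆ O := by
    rwa [ball_prod_same]
  have hz₀ : p₀.1 ∈ ball p₀.1 r := mem_ball_self hr
  have hw₀ : p₀.2 ∈ ball p₀.2 r := mem_ball_self hr
  have hdu : ∀ z ∈ ball p₀.1 r, ∀ w ∈ ball p₀.2 r, DifferentiableAt ℂ u (z, w) :=
    fun z hz w hw => hu.differentiableAt (hO.mem_nhds (hsub ⟨hz, hw⟩))
  have hdv : ∀ z ∈ ball p₀.1 r, ∀ w ∈ ball p₀.2 r, DifferentiableAt ℂ v (z, w) :=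
    fun z hz w hw => hv.differentiableAt (hO.mem_nhds (hsub ⟨hz, hw⟩))
  have hu' : ∀ z ∈ ball p₀.1 r, ∀ w ∈ ball p₀.2 r, u (z, w) = u (z, p₀.2) := by
    intro z hz w hw
    refine isOpen_ball.is_const_of_deriv_eq_zero (f := fun w => u (z, w))
      (convex_ball p₀.2 r).isPreconnected
      (fun w hw => (hdu z hz w hw).hasDerivAt_snd.differentiableAt.differentiableWithinAt)
      (fun w hw => ?_) hw hw₀
    rw [(hdu z hz w hw).hasDerivAt_snd.deriv, hu₂ _ (hsub ⟨hz, hw⟩), Pi.zero_apply]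
  have hv' : ∀ z ∈ ball p₀.1 r, ∀ w ∈ ball p₀.2 r, v (z, w) = v (p₀.1, w) := by
    intro z hz w hw
    refine isOpen_ball.is_const_of_deriv_eq_zero (f := fun z => v (z, w))
      (convex_ball p₀.1 r).isPreconnected
      (fun z hz => (hdv z hz w hw).hasDerivAt_fst.differentiableAt.differentiableWithinAt)
      (fun z hz => ?_) hz hz₀
    rw [(hdv z hz w hw).hasDerivAt_fst.deriv, hv₁ _ (hsub ⟨hz, hw⟩), Pi.zero_apply]
  have hloc : ∀ z ∈ ball p₀.1 r, ∀ w ∈ ball p₀.2 r, (u (z, p₀.2) - v (p₀.1, w)) ^ 2 =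
      (z - w) ^ 2 * (deriv (fun z => u (z, p₀.2)) z * deriv (fun w => v (p₀.1, w)) w) := by
    intro z hz w hw
    have e₁ : fderiv ℂ u (z, w) (1, 0) = deriv (fun z => u (z, p₀.2)) z := by
      rw [← (hdu z hz w hw).hasDerivAt_fst.deriv]
      refine EventuallyEq.deriv_eq ?_
      filter_upwards [isOpen_ball.mem_nhds hz] with x hx using hu' x hx w hw
    have e₂ : fderiv ℂ v (z, w) (0, 1) = deriv (fun w => v (p₀.1, w)) w := by
      rw [← (hdv z hz w hw).hasDerivAt_snd.deriv]
      refine EventuallyEq.deriv_eq ?_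
      filter_upwards [isOpen_ball.mem_nhds hw] with x hx using hv' z hz x hx
    rw [← hu' z hz w hw, ← hv' z hz w hw, ← e₁, ← e₂]
    exact (h (z, w) (hsub ⟨hz, hw⟩)).symm
  have hnt : ∀ x : ℂ, (ball x r).Nontrivial := fun x =>
    (infinite_of_mem_nhds x (ball_mem_nhds x hr)).nontrivial
  obtain ⟨a, b, c, d, hdet, hum, hvm⟩ := exists_moebius_of_sq_sub_eq
    (f := fun z => u (z, p₀.2)) (g := fun w => v (p₀.1, w))
    (convex_ball p₀.1 r).isPreconnected (convex_ball p₀.2 r).isPreconnected (hnt _) (hnt _)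
    (fun z hz =>
      (hdu z hz _ hw₀).hasDerivAt_fst.differentiableAt.continuousAt.continuousWithinAt)
    (fun w hw =>
      (hdv _ hz₀ w hw).hasDerivAt_snd.differentiableAt.continuousAt.continuousWithinAt)
    (fun z hz w hw => hOG (hsub (mk_mem_prod hz hw)))
    (fun z hz w hw => by
      rw [← hu' z hz w hw, ← hv' z hz w hw]
      exact huv _ (hsub ⟨hz, hw⟩))
    hloc
  have hball' : ∀ᶠ p in 𝓝 p₀, p.1 ∈ ball p₀.1 r ∧ p.2 ∈ ball p₀.2 r := by
    filter_upwards [ball_mem_nhds p₀ hr] with p hp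
    rwa [← ball_prod_same] at hp
  have hU : EqOn (fun p => (c * p.1 + d) * u p - (a * p.1 + b)) 0 O := by
    refine eqOn_zero_of_differentiableOn_of_preconnected
      (by fun_prop) hO hOc.isPreconnected hp₀ ?_
    filter_upwards [hball'] with p hp
    have := hum p.1 hp.1
    rw [← hu' p.1 hp.1 p.2 hp.2] at this
    simpa [sub_eq_zero] using this
  have hV : EqOn (fun p => (c * p.2 + d) * v p - (a * p.2 + b)) 0 O := by
    refine eqOn_zero_of_differentiableOn_of_preconnected
      (by fun_prop) hO hOc.isPreconnected hp₀ ?_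
    filter_upwards [hball'] with p hp
    have := hvm p.2 hp.2
    rw [← hv' p.1 hp.1 p.2 hp.2] at this
    simpa [sub_eq_zero] using this
  have hden : ∀ x y : ℂ, (c * x + d) * y - (a * x + b) = 0 → c * x + d ≠ 0 := by
    intro x y hxy h0
    exact hdet (by linear_combination (a - c * y) * h0 + c * hxy)
  refine ⟨a, b, c, d, hdet, fun p hp => ?_⟩
  have h₁ : (c * p.1 + d) * u p - (a * p.1 + b) = 0 := hU hp
  have h₂ : (c * p.2 + d) * v p - (a * p.2 + b) = 0 := hV hp
  refine ⟨⟨hden _ _ h₁, hden _ _ h₂⟩, ?_, ?_⟩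
  · rw [eq_div_iff (hden _ _ h₁)]
    linear_combination h₁
  · rw [eq_div_iff (hden _ _ h₂)]
    linear_combination h₂

end Moebius

/-- the maps leaving the Laplacian (z−w)²∂_z∂_w on G₀ invariant are
exactly the diagonal Möbius maps (ψ(z), ψ(w)) and their flips (ψ(w), ψ(z)). -/
theorem laplacian_invariance_implies_moebius
    (O : Set (ℂ × ℂ)) (hO : IsOpen O) (hOc : IsConnected O) (hOG : O ⊆ G0)
    (T₁ T₂ : ℂ × ℂ → ℂ)
    (hT₁ : DifferentiableOn ℂ T₁ O) (hT₂ : DifferentiableOn ℂ T₂ O)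
    (hTmaps : ∀ p ∈ O, ((T₁ p, T₂ p) : ℂ × ℂ) ∈ G0)
    (hinv : ∀ F : ℂ × ℂ → ℂ, DifferentiableOn ℂ F G0 →
      ∀ p ∈ O, (p.1 - p.2) ^ 2 * mixedDeriv (fun q => F (T₁ q, T₂ q)) p
        = (T₁ p - T₂ p) ^ 2 * mixedDeriv F (T₁ p, T₂ p)) :
    ∃ a b c d : ℂ, a * d - b * c ≠ 0 ∧
      ((∀ p ∈ O, (c * p.1 + d ≠ 0 ∧ c * p.2 + d ≠ 0) ∧
          T₁ p = (a * p.1 + b) / (c * p.1 + d) ∧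
          T₂ p = (a * p.2 + b) / (c * p.2 + d)) ∨
       (∀ p ∈ O, (c * p.2 + d ≠ 0 ∧ c * p.1 + d ≠ 0) ∧
          T₁ p = (a * p.2 + b) / (c * p.2 + d) ∧
          T₂ p = (a * p.1 + b) / (c * p.1 + d))) := by
  have hne : ∀ p ∈ O, (p.1 - p.2) ^ 2 ≠ 0 := fun p hp =>
    pow_ne_zero 2 (sub_ne_zero.2 (hOG hp))
  have hT : ∀ p ∈ O, T₁ p ≠ T₂ p := hTmaps
  have hm₁ : ∀ p ∈ O, mixedDeriv T₁ p = 0 := fun p hp => by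
    have := hinv (fun q => q.1) (by fun_prop) p hp
    simpa [mixedDeriv, sub_ne_zero.2 (hOG hp)] using this
  have hm₂ : ∀ p ∈ O, mixedDeriv T₂ p = 0 := fun p hp => by
    have := hinv (fun q => q.2) (by fun_prop) p hp
    simpa [mixedDeriv, sub_ne_zero.2 (hOG hp)] using this
  have hsq₁ : ∀ p ∈ O, fderiv ℂ T₁ p (1, 0) * fderiv ℂ T₁ p (0, 1) = 0 := fun p hp => by
    have := hinv (fun q => q.1 * q.1) (by fun_prop) p hp
    have h0 : mixedDeriv (fun q => q.1 * q.1) (T₁ p, T₂ p) = 0 := by simp [mixedDeriv]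
    rw [mixedDeriv_mul hT₁ hT₁ hO hp, hm₁ p hp, h0, mul_zero (_ ^ 2), mul_eq_zero] at this
    linear_combination (this.resolve_left (hne p hp)) / 2
  have hsq₂ : ∀ p ∈ O, fderiv ℂ T₂ p (1, 0) * fderiv ℂ T₂ p (0, 1) = 0 := fun p hp => by
    have := hinv (fun q => q.2 * q.2) (by fun_prop) p hp
    have h0 : mixedDeriv (fun q => q.2 * q.2) (T₁ p, T₂ p) = 0 := by simp [mixedDeriv]
    rw [mixedDeriv_mul hT₂ hT₂ hO hp, hm₂ p hp, h0, mul_zero (_ ^ 2), mul_eq_zero] at this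
    linear_combination (this.resolve_left (hne p hp)) / 2
  have hprod : ∀ p ∈ O, (p.1 - p.2) ^ 2 * (fderiv ℂ T₁ p (1, 0) * fderiv ℂ T₂ p (0, 1) +
      fderiv ℂ T₁ p (0, 1) * fderiv ℂ T₂ p (1, 0)) = (T₁ p - T₂ p) ^ 2 := fun p hp => by
    have := hinv (fun q => q.1 * q.2) (by fun_prop) p hp
    have h1 : mixedDeriv (fun q => q.1 * q.2) (T₁ p, T₂ p) = 1 := by simp [mixedDeriv]
    rw [mixedDeriv_mul hT₁ hT₂ hO hp, hm₁ p hp, hm₂ p hp, h1] at this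
    linear_combination this
  have hsum : ∀ p ∈ O, fderiv ℂ T₁ p (1, 0) * fderiv ℂ T₂ p (0, 1) +
      fderiv ℂ T₁ p (0, 1) * fderiv ℂ T₂ p (1, 0) ≠ 0 := fun p hp h0 => by
    have := hprod p hp
    rw [h0, mul_zero] at this
    exact pow_ne_zero 2 (sub_ne_zero.2 (hT p hp)) this.symm
  have hopen : ∀ e : ℂ × ℂ, IsOpen (O ∩ (fun p => fderiv ℂ T₁ p e) ⁻¹' {0}ᶜ) := fun e =>
    (differentiableOn_fderiv_apply_const hT₁ hO e).continuousOn.isOpen_inter_preimage hO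
      isOpen_compl_singleton
  have hcases : O ⊆ O ∩ (fun p => fderiv ℂ T₁ p (1, 0)) ⁻¹' {0}ᶜ ∨
      O ⊆ O ∩ (fun p => fderiv ℂ T₁ p (0, 1)) ⁻¹' {0}ᶜ := by
    refine isPreconnected_iff_subset_of_disjoint.1 hOc.isPreconnected _ _ (hopen _) (hopen _)
      (fun p hp => ?_) ?_
    · by_cases h1 : fderiv ℂ T₁ p (1, 0) = 0
      · refine Or.inr ⟨hp, fun h2 => hsum p hp ?_⟩
        have h2' : fderiv ℂ T₁ p (0, 1) = 0 := h2
        rw [h1, h2', zero_mul, zero_mul, add_zero]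
      · exact Or.inl ⟨hp, h1⟩
    · refine Set.eq_empty_of_forall_notMem fun p hp => ?_
      exact mul_ne_zero hp.2.1.2 hp.2.2.2 (hsq₁ p hp.1)
  rcases hcases with hcase | hcase
  · have hu : ∀ p ∈ O, fderiv ℂ T₁ p (0, 1) = 0 := fun p hp =>
      (mul_eq_zero.1 (hsq₁ p hp)).resolve_left (hcase hp).2
    have hv : ∀ p ∈ O, fderiv ℂ T₂ p (1, 0) = 0 := fun p hp =>
      (mul_eq_zero.1 (hsq₂ p hp)).resolve_right fun h0 =>
        hsum p hp (by rw [h0, hu p hp, mul_zero, zero_mul, add_zero])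
    obtain ⟨a, b, c, d, hdet, h⟩ := exists_moebius_of_separated hO hOc hOG hT₁ hT₂ hT hu hv
      fun p hp => by rw [← hprod p hp, hu p hp]; ring
    exact ⟨a, b, c, d, hdet, Or.inl h⟩
  · have hu : ∀ p ∈ O, fderiv ℂ T₁ p (1, 0) = 0 := fun p hp =>
      (mul_eq_zero.1 (hsq₁ p hp)).resolve_right (hcase hp).2
    have hv : ∀ p ∈ O, fderiv ℂ T₂ p (0, 1) = 0 := fun p hp =>
      (mul_eq_zero.1 (hsq₂ p hp)).resolve_left fun h0 =>
        hsum p hp (by rw [h0, hu p hp, mul_zero, zero_mul, add_zero])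
    obtain ⟨a, b, c, d, hdet, h⟩ := exists_moebius_of_separated hO hOc hOG hT₂ hT₁
      (fun p hp => (hT p hp).symm) hv hu
      fun p hp => by rw [← neg_sub (T₁ p), neg_sq, ← hprod p hp, hu p hp]; ring
    refine ⟨a, b, c, d, hdet, Or.inr fun p hp => ?_⟩
    obtain ⟨⟨h₁, h₂⟩, h₃, h₄⟩ := h p hp
    exact ⟨⟨h₂, h₁⟩, h₄, h₃⟩
end

section
/- Let O ⊆ Ω₀ = {(z,w) ∈ ℂ × ℂ : z·w ≠ 1} be a nonempty open connected set and let T = (T₁, T₂) : O → Ω₀ be holomorphic. Assume that on O: (∂_zT₁)·(∂_zT₂) = 0, (∂_wT₁)·(∂_wT₂) = 0, and ((∂_zT₁)(∂_wT₂) + (∂_wT₁)(∂_zT₂)) · (1 − zw)² = (1 − T₁T₂)². Then there exist a,b,c,d ∈ ℂ with ad − bc ≠ 0 such that either T(z,w) = ((az+b)/(cz+d), (dw+c)/(bw+a)) for all (z,w) ∈ O, or T(z,w) = ((aw+b)/(cw+d), (dz+c)/(bz+a)) for all (z,w) ∈ O. -/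
open Complex

/-- Partial derivative in the first variable. -/
noncomputable def pderivZ (f : ℂ × ℂ → ℂ) (p : ℂ × ℂ) : ℂ :=
  deriv (fun z => f (z, p.2)) p.1

/-- Partial derivative in the second variable. -/
noncomputable def pderivW (f : ℂ × ℂ → ℂ) (p : ℂ × ℂ) : ℂ :=
  deriv (fun w => f (p.1, w)) p.2

open Metric Filter Topology in
/-- Identity theorem for holomorphic functions on a connected open subset of a normed space. -/
theorem eqOn_zero_of_isPreconnected_of_eventuallyEq_zero
    {E : Type*} [NormedAddCommGroup E] [NormedSpace ℂ E] {U : Set E} (hU : IsOpen U)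
    (hUc : IsPreconnected U) {F : E → ℂ} (hF : DifferentiableOn ℂ F U) {p₀ : E} (hp₀ : p₀ ∈ U)
    (h₀ : F =ᶠ[𝓝 p₀] 0) : Set.EqOn F 0 U := by
  have hsub : U ⊆ {p | F =ᶠ[𝓝 p] 0} := by
    refine hUc.subset_of_closure_inter_subset isOpen_setOfPred_eventually_nhds ⟨p₀, hp₀, h₀⟩ ?_
    rintro p ⟨hpc, hpU⟩
    obtain ⟨r, hr, hball⟩ := isOpen_iff.1 hU p hpU
    obtain ⟨q, hqp, hq⟩ := mem_closure_iff.1 hpc (ball p r) isOpen_ball (mem_ball_self hr)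
    refine mem_of_superset (ball_mem_nhds p hr) fun x hx => ?_
    let l : ℂ → E := fun t => q + t • (x - q)
    have hl : Differentiable ℂ l := by fun_prop
    have hV : IsOpen (l ⁻¹' ball p r) := isOpen_ball.preimage hl.continuous
    have hVc : Convex ℝ (l ⁻¹' ball p r) := by
      intro s hs t ht α β hα hβ hαβ
      have : l (α • s + β • t) = α • l s + β • l t := by
        simp only [l, smul_add, add_smul, smul_assoc]
        rw [add_add_add_comm, ← add_smul, hαβ, one_smul]
      rw [Set.mem_preimage, this]
      exact convex_ball p r hs ht hα hβ hαβ
    have hA : AnalyticOnNhd ℂ (F ∘ l) (l ⁻¹' ball p r) :=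
      (hF.comp hl.differentiableOn fun t ht => hball ht).analyticOnNhd hV
    have hl0 : l 0 = q := by simp [l]
    have hl1 : l 1 = x := by simp [l]
    have hz : F ∘ l =ᶠ[𝓝 0] 0 := by
      have := hl.continuous.tendsto 0
      rw [hl0] at this
      exact this.eventually hq
    have := hA.eqOn_zero_of_preconnected_of_eventuallyEq_zero hVc.isPreconnected
      (show l 0 ∈ ball p r from hl0 ▸ hqp) hz (show l 1 ∈ ball p r from hl1 ▸ hx)
    simpa [hl1] using this
  exact fun p hp => (hsub hp).self_of_nhds

/-- Solutions of the Riccati-type equation `m f' (1 - z w₀)² = (1 - f g₀)²` are Möbius. -/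
theorem moebius_of_deriv_eq {D : Set ℂ} (hD : IsOpen D) (hDc : IsPreconnected D) {f : ℂ → ℂ}
    (hf : DifferentiableOn ℂ f D) {z₀ w₀ g₀ m : ℂ} (hz₀ : z₀ ∈ D)
    (hw : ∀ z ∈ D, 1 - z * w₀ ≠ 0) (hg : ∀ z ∈ D, 1 - f z * g₀ ≠ 0)
    (hm : m ≠ 0) (h : ∀ z ∈ D, deriv f z * m * (1 - z * w₀) ^ 2 = (1 - f z * g₀) ^ 2)
    {z : ℂ} (hz : z ∈ D) :
    (f z - f z₀) * (1 - z * w₀) =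
      (1 - f z₀ * g₀) / (m * (1 - z₀ * w₀)) * ((z - z₀) * (1 - f z * g₀)) := by
  have hu : ∀ z ∈ D, HasDerivAt (fun z => (f z - f z₀) / (1 - f z * g₀))
      ((deriv f z * (1 - f z * g₀) - (f z - f z₀) * (-(deriv f z * g₀))) / (1 - f z * g₀) ^ 2)
      z := fun z hz => by
    have hfz := (hf.differentiableAt (hD.mem_nhds hz)).hasDerivAt
    exact (hfz.sub_const _).div ((hfz.mul_const g₀).const_sub 1) (hg z hz)
  have hv : ∀ z ∈ D, HasDerivAt
      (fun z => (1 - f z₀ * g₀) / (m * (1 - z₀ * w₀)) * ((z - z₀) / (1 - z * w₀)))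
      ((1 - f z₀ * g₀) / (m * (1 - z₀ * w₀)) *
        ((1 * (1 - z * w₀) - (z - z₀) * (-(1 * w₀))) / (1 - z * w₀) ^ 2))
      z := fun z hz =>
    (((hasDerivAt_id' z).sub_const _).div (((hasDerivAt_id' z).mul_const w₀).const_sub 1)
      (hw z hz)).const_mul _
  have key := hD.eqOn_of_deriv_eq hDc
    (fun z hz => (hu z hz).differentiableAt.differentiableWithinAt)
    (fun z hz => (hv z hz).differentiableAt.differentiableWithinAt)
    (fun z hz => by
      rw [(hu z hz).deriv, (hv z hz).deriv]
      have h1 := hw z hz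
      have h2 := hg z hz
      have h3 := hw z₀ hz₀
      rw [← h z hz]
      have h4 : deriv f z ≠ 0 := fun h0 => by
        have := h z hz
        rw [h0, zero_mul, zero_mul] at this
        exact pow_ne_zero 2 h2 this.symm
      have h5 : (1 - f z₀ * g₀) / (m * (1 - z₀ * w₀)) * (1 * (1 - z * w₀) - (z - z₀) * -(1 * w₀)) =
          (1 - f z₀ * g₀) / m := by
        field_simp
        ring
      rw [← mul_div_assoc, h5]
      field_simp
      ring) hz₀ (by simp) hz
  have h1 := hw z hz
  have h2 := hg z hz
  dsimp only at key
  rw [div_eq_iff h2] at key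
  rw [key, mul_assoc, mul_assoc]
  congr 1
  field_simp

/-- If `f' g' = 0` on a connected open set and `f' ≠ 0` at some point, then
`g' = 0` all along. -/
theorem deriv_eq_zero_of_mul_eq_zero {D : Set ℂ} (hD : IsOpen D) (hDc : IsPreconnected D)
    {f g : ℂ → ℂ} (hf : DifferentiableOn ℂ f D) (hg : DifferentiableOn ℂ g D)
    (h : ∀ z ∈ D, deriv f z * deriv g z = 0) {z₀ : ℂ} (hz₀ : z₀ ∈ D) (h₀ : deriv f z₀ ≠ 0) :
    ∀ z ∈ D, deriv g z = 0 :=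
  ((hf.analyticOnNhd hD).deriv.eq_zero_or_eq_zero_of_mul_eq_zero (hg.analyticOnNhd hD).deriv h
    hDc).resolve_left fun hz => h₀ (hz z₀ hz₀)

theorem one_sub_mul_ne_zero_of_mem {z w : ℂ} (h : (z, w) ∈ Omega0) : 1 - z * w ≠ 0 :=
  sub_ne_zero.2 (Ne.symm h)

/-- On a product of connected open sets, a holomorphic isometry with `∂_z T₁ ≠ 0` at some point
is a Möbius map. -/
theorem moebius_on_prod {D E : Set ℂ} (hD : IsOpen D) (hDc : IsPreconnected D)
    (hE : IsOpen E) (hEc : IsPreconnected E) (hΩ : D ×ˢ E ⊆ Omega0)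
    {T₁ T₂ : ℂ × ℂ → ℂ}
    (hT₁ : DifferentiableOn ℂ T₁ (D ×ˢ E)) (hT₂ : DifferentiableOn ℂ T₂ (D ×ˢ E))
    (hTmaps : ∀ p ∈ D ×ˢ E, ((T₁ p, T₂ p) : ℂ × ℂ) ∈ Omega0)
    (hzz : ∀ p ∈ D ×ˢ E, pderivZ T₁ p * pderivZ T₂ p = 0)
    (hww : ∀ p ∈ D ×ˢ E, pderivW T₁ p * pderivW T₂ p = 0)
    (hzw : ∀ p ∈ D ×ˢ E,
      (pderivZ T₁ p * pderivW T₂ p + pderivW T₁ p * pderivZ T₂ p)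
        * (1 - p.1 * p.2) ^ 2 = (1 - T₁ p * T₂ p) ^ 2)
    {p₀ : ℂ × ℂ} (hp₀ : p₀ ∈ D ×ˢ E) (hne : pderivZ T₁ p₀ ≠ 0) :
    ∃ a b c d : ℂ, a * d - b * c ≠ 0 ∧ ∀ p ∈ D ×ˢ E,
      T₁ p * (c * p.1 + d) = a * p.1 + b ∧ T₂ p * (b * p.2 + a) = d * p.2 + c := by
  obtain ⟨z₀, w₀⟩ := p₀
  obtain ⟨hz₀, hw₀⟩ : z₀ ∈ D ∧ w₀ ∈ E := hp₀
  have hsliceZ : ∀ {T : ℂ × ℂ → ℂ}, DifferentiableOn ℂ T (D ×ˢ E) → ∀ w ∈ E,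
      DifferentiableOn ℂ (fun z => T (z, w)) D := fun hT w hw =>
    hT.comp (by fun_prop) fun z hz => ⟨hz, hw⟩
  have hsliceW : ∀ {T : ℂ × ℂ → ℂ}, DifferentiableOn ℂ T (D ×ˢ E) → ∀ z ∈ D,
      DifferentiableOn ℂ (fun w => T (z, w)) E := fun hT z hz =>
    hT.comp (by fun_prop) fun w hw => ⟨hz, hw⟩
  have hΩ' : ∀ z ∈ D, ∀ w ∈ E, 1 - z * w ≠ 0 := fun z hz w hw =>
    one_sub_mul_ne_zero_of_mem (hΩ (Set.mk_mem_prod hz hw))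
  have hT' : ∀ z ∈ D, ∀ w ∈ E, 1 - T₁ (z, w) * T₂ (z, w) ≠ 0 := fun z hz w hw =>
    one_sub_mul_ne_zero_of_mem (hTmaps (z, w) ⟨hz, hw⟩)
  have hT₂z₀ : ∀ z ∈ D, pderivZ T₂ (z, w₀) = 0 :=
    deriv_eq_zero_of_mul_eq_zero hD hDc (hsliceZ hT₁ w₀ hw₀) (hsliceZ hT₂ w₀ hw₀)
      (fun z hz => hzz (z, w₀) ⟨hz, hw₀⟩) hz₀ hne
  have hT₁w : ∀ z ∈ D, ∀ w ∈ E, pderivW T₁ (z, w) = 0 := by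
    intro z hz
    refine deriv_eq_zero_of_mul_eq_zero hE hEc (hsliceW hT₂ z hz) (hsliceW hT₁ z hz)
      (fun w hw => by rw [mul_comm]; exact hww (z, w) ⟨hz, hw⟩) hw₀ fun h0 => ?_
    have := hzw (z, w₀) ⟨hz, hw₀⟩
    rw [hT₂z₀ z hz, show pderivW T₂ (z, w₀) = 0 from h0] at this
    exact pow_ne_zero 2 (hT' z hz w₀ hw₀) (by rw [← this]; ring)
  have hzw' : ∀ z ∈ D, ∀ w ∈ E, pderivZ T₁ (z, w) * pderivW T₂ (z, w) * (1 - z * w) ^ 2 =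
      (1 - T₁ (z, w) * T₂ (z, w)) ^ 2 := fun z hz w hw => by
    have := hzw (z, w) ⟨hz, hw⟩
    rwa [hT₁w z hz w hw, zero_mul, add_zero] at this
  have hT₂z : ∀ z ∈ D, ∀ w ∈ E, pderivZ T₂ (z, w) = 0 := fun z hz w hw =>
    (mul_eq_zero.1 (hzz (z, w) ⟨hz, hw⟩)).resolve_left fun h0 => by
      have := hzw' z hz w hw
      rw [h0, zero_mul, zero_mul] at this
      exact pow_ne_zero 2 (hT' z hz w hw) this.symm
  have hc₁ : ∀ z ∈ D, ∀ w ∈ E, T₁ (z, w) = T₁ (z, w₀) := fun z hz w hw =>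
    hE.is_const_of_deriv_eq_zero hEc (hsliceW hT₁ z hz) (hT₁w z hz) hw hw₀
  have hc₂ : ∀ z ∈ D, ∀ w ∈ E, T₂ (z, w) = T₂ (z₀, w) := fun z hz w hw =>
    hD.is_const_of_deriv_eq_zero hDc (hsliceZ hT₂ w hw) (fun z hz => hT₂z z hz w hw) hz hz₀
  have hd₁ : ∀ z ∈ D, ∀ w ∈ E, pderivZ T₁ (z, w) = pderivZ T₁ (z, w₀) := fun z hz w hw =>
    Set.EqOn.deriv (fun z hz => hc₁ z hz w hw) hD hz
  have hd₂ : ∀ z ∈ D, ∀ w ∈ E, pderivW T₂ (z, w) = pderivW T₂ (z₀, w) := fun z hz w hw =>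
    Set.EqOn.deriv (fun w hw => hc₂ z hz w hw) hE hw
  have hm := hzw' z₀ hz₀ w₀ hw₀
  have hΩ₀ := hΩ' z₀ hz₀ w₀ hw₀
  have hT₀ := hT' z₀ hz₀ w₀ hw₀
  have hne₂ : pderivW T₂ (z₀, w₀) ≠ 0 := fun h0 => by
    rw [h0, mul_zero, zero_mul] at hm
    exact pow_ne_zero 2 hT₀ hm.symm
  have hf : ∀ z ∈ D, _ := fun z hz =>
    moebius_of_deriv_eq (w₀ := w₀) (g₀ := T₂ (z₀, w₀)) (m := pderivW T₂ (z₀, w₀)) hD hDc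
      (hsliceZ hT₁ w₀ hw₀) hz₀ (fun z hz => hΩ' z hz w₀ hw₀)
      (fun z hz => hc₂ z hz w₀ hw₀ ▸ hT' z hz w₀ hw₀) hne₂
      (fun z hz => by
        have := hzw' z hz w₀ hw₀
        rwa [hd₂ z hz w₀ hw₀, hc₂ z hz w₀ hw₀] at this) hz
  have hg : ∀ w ∈ E, _ := fun w hw =>
    moebius_of_deriv_eq (w₀ := z₀) (g₀ := T₁ (z₀, w₀)) (m := pderivZ T₁ (z₀, w₀)) hE hEc
      (hsliceW hT₂ z₀ hz₀) hw₀ (fun w hw => by rw [mul_comm]; exact hΩ' z₀ hz₀ w hw)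
      (fun w hw => by rw [mul_comm, ← hc₁ z₀ hz₀ w hw]; exact hT' z₀ hz₀ w hw) hne
      (fun w hw => by
        have := hzw' z₀ hz₀ w hw
        rw [hd₁ z₀ hz₀ w hw, hc₁ z₀ hz₀ w hw] at this
        rw [mul_comm w, mul_comm (T₂ _), ← this, mul_comm (pderivZ T₁ _)]
        rfl) hw
  set f₀ := T₁ (z₀, w₀)
  set g₀ := T₂ (z₀, w₀)
  set K := (1 - f₀ * g₀) / (pderivW T₂ (z₀, w₀) * (1 - z₀ * w₀)) with hK
  have hK0 : K ≠ 0 := div_ne_zero hT₀ (mul_ne_zero hne₂ hΩ₀)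
  have hL : (1 - g₀ * f₀) / (pderivZ T₁ (z₀, w₀) * (1 - w₀ * z₀)) = K⁻¹ := by
    rw [hK, inv_div, mul_comm g₀, mul_comm w₀, div_eq_div_iff (mul_ne_zero hne hΩ₀) hT₀]
    linear_combination -hm
  rw [hL] at hg
  refine ⟨K - f₀ * w₀, f₀ - K * z₀, K * g₀ - w₀, 1 - K * g₀ * z₀, ?_, ?_⟩
  · have : K * (1 - f₀ * g₀) * (1 - z₀ * w₀) ≠ 0 := mul_ne_zero (mul_ne_zero hK0 hT₀) hΩ₀
    intro h0
    apply this
    linear_combination h0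
  · rintro ⟨z, w⟩ ⟨hz, hw⟩
    rw [hc₁ z hz w hw, hc₂ z hz w hw]
    refine ⟨by linear_combination hf z hz, ?_⟩
    have h1 : K * ((T₂ (z₀, w) - g₀) * (1 - w * z₀)) = (w - w₀) * (1 - T₂ (z₀, w) * f₀) := by
      rw [hg w hw, mul_inv_cancel_left₀ hK0]
    linear_combination h1

/-- If `t (c x + d) = a x + b` with `ad - bc ≠ 0`, the denominator `c x + d` cannot vanish. -/
theorem denom_ne_zero_of_mul_eq {a b c d t x : ℂ} (hdet : a * d - b * c ≠ 0)
    (h : t * (c * x + d) = a * x + b) : c * x + d ≠ 0 := fun h0 => by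
  rw [h0, mul_zero] at h
  exact hdet (by linear_combination a * h0 + c * h)

/-- A holomorphic isometry with `∂_z T₁ ≠ 0` at some point is a Möbius map which does not swap the
variables. -/
theorem moebius_of_pderivZ_ne_zero
    {O : Set (ℂ × ℂ)} (hO : IsOpen O) (hOc : IsPreconnected O) (hOΩ : O ⊆ Omega0)
    {T₁ T₂ : ℂ × ℂ → ℂ}
    (hT₁ : DifferentiableOn ℂ T₁ O) (hT₂ : DifferentiableOn ℂ T₂ O)
    (hTmaps : ∀ p ∈ O, ((T₁ p, T₂ p) : ℂ × ℂ) ∈ Omega0)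
    (hzz : ∀ p ∈ O, pderivZ T₁ p * pderivZ T₂ p = 0)
    (hww : ∀ p ∈ O, pderivW T₁ p * pderivW T₂ p = 0)
    (hzw : ∀ p ∈ O,
      (pderivZ T₁ p * pderivW T₂ p + pderivW T₁ p * pderivZ T₂ p)
        * (1 - p.1 * p.2) ^ 2 = (1 - T₁ p * T₂ p) ^ 2)
    {p₀ : ℂ × ℂ} (hp₀ : p₀ ∈ O) (hne : pderivZ T₁ p₀ ≠ 0) :
    ∃ a b c d : ℂ, a * d - b * c ≠ 0 ∧
      ∀ p ∈ O, (c * p.1 + d ≠ 0 ∧ b * p.2 + a ≠ 0) ∧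
          T₁ p = (a * p.1 + b) / (c * p.1 + d) ∧
          T₂ p = (d * p.2 + c) / (b * p.2 + a) := by
  obtain ⟨r, hr, hball⟩ := Metric.isOpen_iff.1 hO p₀ hp₀
  have hprod : Metric.ball p₀.1 r ×ˢ Metric.ball p₀.2 r = Metric.ball p₀ r :=
    ball_prod_same p₀.1 p₀.2 r
  rw [← hprod] at hball
  obtain ⟨a, b, c, d, hdet, H⟩ := moebius_on_prod Metric.isOpen_ball
    (convex_ball p₀.1 r).isPreconnected Metric.isOpen_ball (convex_ball p₀.2 r).isPreconnected
    (hball.trans hOΩ) (hT₁.mono hball) (hT₂.mono hball) (fun p hp => hTmaps p (hball hp))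
    (fun p hp => hzz p (hball hp)) (fun p hp => hww p (hball hp))
    (fun p hp => hzw p (hball hp)) (p₀ := p₀)
    ⟨Metric.mem_ball_self hr, Metric.mem_ball_self hr⟩ hne
  rw [hprod] at H
  refine ⟨a, b, c, d, hdet, fun p hp => ?_⟩
  have h₁ : T₁ p * (c * p.1 + d) - (a * p.1 + b) = 0 :=
    eqOn_zero_of_isPreconnected_of_eventuallyEq_zero hO hOc
      (F := fun p => T₁ p * (c * p.1 + d) - (a * p.1 + b)) (by fun_prop) hp₀
      (Filter.mem_of_superset (Metric.ball_mem_nhds p₀ hr) fun q hq => sub_eq_zero.2 (H q hq).1)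
      hp
  have h₂ : T₂ p * (b * p.2 + a) - (d * p.2 + c) = 0 :=
    eqOn_zero_of_isPreconnected_of_eventuallyEq_zero hO hOc
      (F := fun p => T₂ p * (b * p.2 + a) - (d * p.2 + c)) (by fun_prop) hp₀
      (Filter.mem_of_superset (Metric.ball_mem_nhds p₀ hr) fun q hq => sub_eq_zero.2 (H q hq).2)
      hp
  rw [sub_eq_zero] at h₁ h₂
  have hn₁ := denom_ne_zero_of_mul_eq hdet h₁
  have hn₂ := denom_ne_zero_of_mul_eq (by rwa [mul_comm d, mul_comm c]) h₂
  exact ⟨⟨hn₁, hn₂⟩, eq_div_of_mul_eq hn₁ h₁, eq_div_of_mul_eq hn₂ h₂⟩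

/-- local holomorphic isometries of the canonical holomorphic Riemannian
metric g_Ω = (1−zw)^{−2} dz∨dw (written out in coordinates as the three displayed
equations) are exactly the Möbius automorphisms of Ω. -/
theorem metric_isometries_are_moebius
    (O : Set (ℂ × ℂ)) (hO : IsOpen O) (hOc : IsConnected O) (hOΩ : O ⊆ Omega0)
    (T₁ T₂ : ℂ × ℂ → ℂ)
    (hT₁ : DifferentiableOn ℂ T₁ O) (hT₂ : DifferentiableOn ℂ T₂ O)
    (hTmaps : ∀ p ∈ O, ((T₁ p, T₂ p) : ℂ × ℂ) ∈ Omega0)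
    (hzz : ∀ p ∈ O, pderivZ T₁ p * pderivZ T₂ p = 0)
    (hww : ∀ p ∈ O, pderivW T₁ p * pderivW T₂ p = 0)
    (hzw : ∀ p ∈ O,
      (pderivZ T₁ p * pderivW T₂ p + pderivW T₁ p * pderivZ T₂ p)
        * (1 - p.1 * p.2) ^ 2 = (1 - T₁ p * T₂ p) ^ 2) :
    ∃ a b c d : ℂ, a * d - b * c ≠ 0 ∧
      ((∀ p ∈ O, (c * p.1 + d ≠ 0 ∧ b * p.2 + a ≠ 0) ∧
          T₁ p = (a * p.1 + b) / (c * p.1 + d) ∧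
          T₂ p = (d * p.2 + c) / (b * p.2 + a)) ∨
       (∀ p ∈ O, (c * p.2 + d ≠ 0 ∧ b * p.1 + a ≠ 0) ∧
          T₁ p = (a * p.2 + b) / (c * p.2 + d) ∧
          T₂ p = (d * p.1 + c) / (b * p.1 + a))) := by
  obtain ⟨p₀, hp₀⟩ := hOc.nonempty
  by_cases hne : pderivZ T₁ p₀ = 0
  · have hne' : pderivW T₁ p₀ ≠ 0 := fun h0 => by
      have := hzw p₀ hp₀
      rw [hne, h0, zero_mul, zero_mul, add_zero, zero_mul] at this
      exact pow_ne_zero 2 (one_sub_mul_ne_zero_of_mem (hTmaps p₀ hp₀)) this.symm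
    have hswap : DifferentiableOn ℂ (Prod.swap : ℂ × ℂ → ℂ × ℂ) (Prod.swap ⁻¹' O) :=
      (differentiable_snd.prodMk differentiable_fst).differentiableOn
    obtain ⟨a, b, c, d, hdet, H⟩ := moebius_of_pderivZ_ne_zero (O := Prod.swap ⁻¹' O)
      (T₁ := T₁ ∘ Prod.swap) (T₂ := T₂ ∘ Prod.swap) (hO.preimage continuous_swap)
      ((Homeomorph.prodComm ℂ ℂ).isPreconnected_preimage.2 hOc.isPreconnected)
      (fun p hp h => hOΩ hp ((mul_comm p.2 p.1).trans h))
      (hT₁.comp hswap fun p hp => hp) (hT₂.comp hswap fun p hp => hp)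
      (fun p hp => hTmaps p.swap hp) (fun p hp => hww p.swap hp) (fun p hp => hzz p.swap hp)
      (fun p hp => by
        have := hzw p.swap hp
        rw [add_comm, Prod.fst_swap, Prod.snd_swap, mul_comm p.2] at this
        exact this)
      (p₀ := p₀.swap) hp₀ hne'
    exact ⟨a, b, c, d, hdet, Or.inr fun p hp => H p.swap hp⟩
  · obtain ⟨a, b, c, d, hdet, H⟩ := moebius_of_pderivZ_ne_zero hO hOc.isPreconnected hOΩ hT₁ hT₂
      hTmaps hzz hww hzw hp₀ hne
    exact ⟨a, b, c, d, hdet, Or.inl H⟩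
end

section
/- Let g : ℂ → ℂ be an entire function. Then the map A(z,w) = (z + g(1/(z−w)), w + g(1/(z−w))) is a holomorphic bijection of G₀ = {(z,w) ∈ ℂ × ℂ : z ≠ w} onto itself; it satisfies A₁(z,w) − A₂(z,w) = z − w for all (z,w) ∈ G₀, and its inverse is the map (z,w) ↦ (z − g(1/(z−w)), w − g(1/(z−w))). -/
open Complex

/-- for every entire g, the map
A(z,w) = (z + g(1/(z−w)), w + g(1/(z−w))) is a holomorphic bijection of G₀ onto itself,
preserves the difference z − w, and has inverse (z,w) ↦ (z − g(1/(z−w)), w − g(1/(z−w))). -/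
theorem shear_automorphism_of_configuration_space
    (g : ℂ → ℂ) (hg : Differentiable ℂ g)
    (A B : ℂ × ℂ → ℂ × ℂ)
    (hA : ∀ p : ℂ × ℂ, A p = (p.1 + g (1 / (p.1 - p.2)), p.2 + g (1 / (p.1 - p.2))))
    (hB : ∀ p : ℂ × ℂ, B p = (p.1 - g (1 / (p.1 - p.2)), p.2 - g (1 / (p.1 - p.2)))) :
    Set.BijOn A G0 G0 ∧
    DifferentiableOn ℂ A G0 ∧
    (∀ p ∈ G0, (A p).1 - (A p).2 = p.1 - p.2) ∧
    (∀ p ∈ G0, B (A p) = p ∧ A (B p) = p) := by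
  have hBA (p : ℂ × ℂ) : B (A p) = p := by simp [hA, hB]
  have hAB (p : ℂ × ℂ) : A (B p) = p := by simp [hA, hB]
  have hAG : Set.MapsTo A G0 G0 := fun p hp => by simpa [G0, hA] using hp
  have hBG : Set.MapsTo B G0 G0 := fun p hp => by simpa [G0, hB] using hp
  refine ⟨Set.InvOn.bijOn ⟨fun p _ => hBA p, fun p _ => hAB p⟩ hAG hBG, ?_,
    fun p _ => by simp [hA], fun p _ => ⟨hBA p, hAB p⟩⟩
  rw [funext hA]
  have hinv : DifferentiableOn ℂ (fun p : ℂ × ℂ => 1 / (p.1 - p.2)) G0 := by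
    simp only [one_div]
    exact (differentiable_fst.sub differentiable_snd).differentiableOn.inv
      fun p hp => sub_ne_zero.mpr hp
  have hshift := hg.comp_differentiableOn hinv
  exact (differentiableOn_fst.add hshift).prodMk (differentiableOn_snd.add hshift)
end
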